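/- For every integer k ≥ 2 and every integer m ≥ 1, the symplectic group Sp(2m, F_{2^k}) over the finite field with 2^k elements has a string C-group representation of rank 2m+1. -/

import Mathlib

/-- A string C-group representation of rank `n` of a group `G`: a family of `n`
involutions generating `G`, satisfying the commuting (string) property and the
intersection property. -/
def IsStringCGroupRep {G : Type*} [Group G] {n : ℕ} (ρ : Fin n → G) : Prop :=
  (∀ i, orderOf (ρ i) = 2) ∧
  Subgroup.closure (Set.range ρ) = ⊤ ∧
  (∀ i j : Fin n, i.val + 1 < j.val → Commute (ρ i) (ρ j)) ∧
  (∀ I J : Set (Fin n),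
    Subgroup.closure (ρ '' I) ⊓ Subgroup.closure (ρ '' J) = Subgroup.closure (ρ '' (I ∩ J)))

section PlaneMoves

/-- The elementary moves `(a, b) ↦ (a, b + α a)` and `(a, b) ↦ (a + α b, b)` of the plane,
together with a third move `(a, b) ↦ (a, b + s a + t)`. -/
def PlaneMove {F : Type*} [Field F] (α s t : F) (p q : F × F) : Prop :=
  q = (p.1, p.2 + α * p.1) ∨ q = (p.1 + α * p.2, p.2) ∨ q = (p.1, p.2 + (s * p.1 + t))

/-- The quadratic form `a² + α a b + b²` on the plane. -/
def planeNorm {F : Type*} [Field F] (α : F) (p : F × F) : F :=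
  p.1 ^ 2 + α * p.1 * p.2 + p.2 ^ 2

/-- The transitivity properties of the moves of the plane with parameter `α`. -/
structure IsGoodParameter {F : Type*} [Field F] (α : F) : Prop where
  ne_zero : α ≠ 0
  /-- the first two moves are transitive on the nonzero vectors of given norm -/
  dihedral : ∀ p q : F × F, p ≠ 0 → q ≠ 0 → planeNorm α p = planeNorm α q →
    Relation.ReflTransGen (PlaneMove α 0 0) p q
  /-- together with an affine move they are transitive on the plane -/
  affine : ∀ β : F, β ≠ 0 → ∀ p q : F × F,
    Relation.ReflTransGen (PlaneMove α α (α * β)) p q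
  /-- together with another linear move they are transitive on nonzero vectors -/
  linear : ∀ δ : F, δ ≠ 0 → δ ≠ α → ∀ p q : F × F, p ≠ 0 → q ≠ 0 →
    Relation.ReflTransGen (PlaneMove α δ 0) p q

open Relation

variable {F : Type*} [Field F]

theorem PlaneMove.symm [CharP F 2] {α s t : F} {p q : F × F} (h : PlaneMove α s t p q) :
    PlaneMove α s t q p := by
  have h2 : (2 : F) = 0 := CharTwo.two_eq_zero
  obtain ⟨a, b⟩ := p
  rcases h with rfl | rfl | rfl
  · left; ext <;> simp; linear_combination -(α * a) * h2
  · right; left; ext <;> simp; linear_combination -(α * b) * h2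
  · right; right; ext <;> simp; linear_combination -(s * a + t) * h2

theorem PlaneMove.reach_symm [CharP F 2] {α s t : F} {p q : F × F}
    (h : ReflTransGen (PlaneMove α s t) p q) : ReflTransGen (PlaneMove α s t) q p := by
  induction h with
  | refl => exact .refl
  | tail _ h ih => exact .head h.symm ih

theorem PlaneMove.reach_mono {α s t : F} {p q : F × F}
    (h : ReflTransGen (PlaneMove α 0 0) p q) : ReflTransGen (PlaneMove α s t) p q := by
  induction h with
  | refl => exact .refl
  | tail _ h ih =>
    rcases h with h | h | h
    · exact ih.tail (.inl h)
    · exact ih.tail (.inr (.inl h))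
    · have : _ = _ := h
      simp at this
      rw [this]; exact ih

theorem exists_sq_eq [Finite F] [CharP F 2] (a : F) : ∃ s : F, s ^ 2 = a := by
  obtain ⟨r, hr⟩ := FiniteField.isSquare_of_char_two (ringChar.eq F 2 |>.symm ▸ rfl) a
  exact ⟨r, by rw [hr, sq]⟩

/-- Iterating a product of two moves scales the eigencoordinates. -/
theorem exists_planeMove_scaled [CharP F 2] {ζ : F} (hζ : ζ ≠ 0) (p : F × F) (j : ℕ) :
    ∃ q : F × F, ReflTransGen (PlaneMove (ζ + ζ⁻¹) 0 0) p q ∧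
      q.1 + ζ * q.2 = ζ ^ (2 * j) * (p.1 + ζ * p.2) ∧
      ζ ^ (2 * j) * (q.1 + ζ⁻¹ * q.2) = p.1 + ζ⁻¹ * p.2 := by
  have h2 : (2 : F) = 0 := CharTwo.two_eq_zero
  induction j with
  | zero => exact ⟨p, .refl, by simp, by simp⟩
  | succ j ih =>
    obtain ⟨q, hq, h1, h3⟩ := ih
    refine ⟨(q.1 + (ζ + ζ⁻¹) * q.2, q.2 + (ζ + ζ⁻¹) * (q.1 + (ζ + ζ⁻¹) * q.2)),
      (hq.tail (.inr (.inl rfl))).tail (.inl rfl), ?_, ?_⟩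
    · have : ζ ^ (2 * (j + 1)) = ζ ^ (2 * j) * ζ ^ 2 := by ring
      rw [this, mul_right_comm, ← h1]
      dsimp only
      field_simp
      linear_combination (ζ * q.1 + q.2 + 2 * ζ ^ 2 * q.2) * h2
    · rw [← h3]
      have : ζ ^ (2 * (j + 1)) = ζ ^ (2 * j) * ζ ^ 2 := by ring
      rw [this, mul_assoc]
      congr 1
      dsimp only
      field_simp
      linear_combination (2 * ζ ^ 2 * q.2 + ζ ^ 3 * q.1 + ζ ^ 4 * q.2) * h2


theorem isGoodParameter_hyperbolic [Finite F] [CharP F 2] {ζ : F} (hζ : ζ ≠ 0)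
    (hα : ζ + ζ⁻¹ ≠ 0) (hα1 : ζ + ζ⁻¹ ≠ 1) (hgen : ∀ u : F, u ≠ 0 → ∃ j : ℕ, ζ ^ j = u) :
    IsGoodParameter (ζ + ζ⁻¹) := by
  have h2 : (2 : F) = 0 := CharTwo.two_eq_zero
  have hζi : ζ * ζ⁻¹ = 1 := mul_inv_cancel₀ hζ
  have hnorm : ∀ p : F × F, planeNorm (ζ + ζ⁻¹) p = (p.1 + ζ * p.2) * (p.1 + ζ⁻¹ * p.2) := by
    intro p; unfold planeNorm; linear_combination -p.2 ^ 2 * hζi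
  have hdet : ∀ p q : F × F, p.1 + ζ * p.2 = q.1 + ζ * q.2 →
      p.1 + ζ⁻¹ * p.2 = q.1 + ζ⁻¹ * q.2 → p = q := by
    intro p q h1 h3
    have h4 : (ζ + ζ⁻¹) * (p.2 + q.2) = 0 := by
      linear_combination h1 + h3 + (q.2 * ζ + q.2 * ζ⁻¹ - p.1 + q.1) * h2
    have h5 : p.2 = q.2 := by
      linear_combination (mul_eq_zero.1 h4).resolve_left hα - q.2 * h2
    ext
    · linear_combination h1 - ζ * h5
    · exact h5
  have swap : ∀ p : F × F, p ≠ 0 → ∃ q, ReflTransGen (PlaneMove (ζ + ζ⁻¹) 0 0) p q ∧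
      q.1 + ζ * q.2 ≠ 0 ∧ planeNorm (ζ + ζ⁻¹) q = planeNorm (ζ + ζ⁻¹) p := by
    intro p hp
    by_cases h : p.1 + ζ * p.2 = 0
    · refine ⟨(p.1 + (ζ + ζ⁻¹) * p.2, p.2), .single (.inr (.inl rfl)), fun h' => hp ?_, ?_⟩
      · refine hdet p 0 (by simpa using h) ?_
        simp only [Prod.fst_zero, Prod.snd_zero]
        linear_combination h' - ζ * p.2 * h2
      · simp only [planeNorm]
        linear_combination ((ζ + ζ⁻¹) * p.1 * p.2 + (ζ + ζ⁻¹) ^ 2 * p.2 ^ 2) * h2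
    · exact ⟨p, .refl, h, rfl⟩
  have dih : ∀ p q : F × F, p ≠ 0 → q ≠ 0 →
      planeNorm (ζ + ζ⁻¹) p = planeNorm (ζ + ζ⁻¹) q →
      ReflTransGen (PlaneMove (ζ + ζ⁻¹) 0 0) p q := by
    intro p q hp hq hpq
    obtain ⟨p', hp', hp0, hpn⟩ := swap p hp
    obtain ⟨q', hq', hq0, hqn⟩ := swap q hq
    refine hp'.trans (ReflTransGen.trans ?_ (PlaneMove.reach_symm hq'))
    obtain ⟨u, hu⟩ := exists_sq_eq ((q'.1 + ζ * q'.2) / (p'.1 + ζ * p'.2))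
    have hu0 : u ≠ 0 := by
      rintro rfl
      exact div_ne_zero hq0 hp0 (by rw [← hu]; simp)
    obtain ⟨j, hj⟩ := hgen u hu0
    obtain ⟨r, hr, h1, h3⟩ := exists_planeMove_scaled hζ p' j
    rw [mul_comm 2 j, pow_mul, hj, hu] at h1 h3
    have e1 : r.1 + ζ * r.2 = q'.1 + ζ * q'.2 := by rw [h1]; field_simp
    have hn : planeNorm (ζ + ζ⁻¹) p' = planeNorm (ζ + ζ⁻¹) q' := by rw [hpn, hqn, hpq]
    rw [hnorm, hnorm, ← h3] at hn
    have e2 : r.1 + ζ⁻¹ * r.2 = q'.1 + ζ⁻¹ * q'.2 := by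
      apply mul_left_cancel₀ hq0
      rw [← hn]; field_simp
    rw [← hdet r q' e1 e2]; exact hr
  have null : ∀ a : F, a ≠ 0 → ((a, a * ζ⁻¹) : F × F) ≠ 0 ∧
      planeNorm (ζ + ζ⁻¹) (a, a * ζ⁻¹) = 0 := by
    intro a ha
    refine ⟨fun h => ha (congrArg Prod.fst h), ?_⟩
    rw [hnorm]
    linear_combination (a + a * ζ⁻¹ ^ 2) * a * hζi + (a + a * ζ⁻¹ ^ 2) * a * h2
  have nn : ∀ p : F × F, planeNorm (ζ + ζ⁻¹) p ≠ 0 → p ≠ 0 := by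
    rintro p h rfl; simp [planeNorm] at h
  have n0 : ((1, ζ⁻¹) : F × F) ≠ 0 := fun h => one_ne_zero (congrArg Prod.fst h)
  have n1 : planeNorm (ζ + ζ⁻¹) (1, ζ⁻¹) = 0 := by simpa using (null 1 one_ne_zero).2
  refine ⟨hα, dih, ?_, ?_⟩
  · intro β hβ
    generalize hαd : ζ + ζ⁻¹ = α at *
    have step : ∀ p : F × F, planeNorm α (p.1, p.2 + (α * p.1 + α * β)) =
        planeNorm α p + α ^ 2 * β * (p.1 + β) := by
      intro p; simp only [planeNorm]
      linear_combination (α * p.2 * p.1 + α * p.2 * β + α ^ 2 * p.1 ^ 2 +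
        α ^ 2 * p.1 * β) * h2
    have key : ∀ p : F × F, p ≠ 0 → planeNorm α p ≠ α ^ 2 * β ^ 2 →
        ReflTransGen (PlaneMove α α (α * β)) p (1, ζ⁻¹) := by
      intro p hp hc
      by_cases h0 : planeNorm α p = 0
      · exact PlaneMove.reach_mono (dih p _ hp n0 (by rw [h0, n1]))
      set a := planeNorm α p / (α ^ 2 * β) + β with ha
      have ha0 : a ≠ 0 := by
        intro h
        apply hc
        rw [ha] at h
        field_simp at h
        linear_combination h - α ^ 2 * β ^ 2 * h2
      have hn : planeNorm α (a, a * ζ⁻¹ + (α * a + α * β)) = planeNorm α p := by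
        have := step (a, a * ζ⁻¹)
        rw [(null a ha0).2] at this
        dsimp only at this
        rw [this, ha]
        field_simp
        linear_combination α ^ 2 * β ^ 2 * h2
      have r1 := PlaneMove.reach_mono (s := α) (t := α * β)
        (dih p _ hp (nn _ (by rw [hn]; exact h0)) hn.symm)
      have r2 := PlaneMove.reach_mono (s := α) (t := α * β)
        (dih _ _ (null a ha0).1 n0 (by rw [(null a ha0).2, n1]))
      have r3 : PlaneMove α α (α * β) (a, a * ζ⁻¹) (a, a * ζ⁻¹ + (α * a + α * β)) :=
        .inr (.inr rfl)
      exact (r1.tail r3.symm).trans r2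
    have key2 : ∀ p : F × F, planeNorm α p = α ^ 2 * β ^ 2 →
        ReflTransGen (PlaneMove α α (α * β)) p (1, ζ⁻¹) := by
      intro p hp
      have hne : α ^ 2 * β ^ 2 ≠ 0 := mul_ne_zero (pow_ne_zero _ hα) (pow_ne_zero _ hβ)
      have hq : planeNorm α ((α * β, 0) : F × F) = α ^ 2 * β ^ 2 := by
        simp [planeNorm, mul_pow]
      have r1 := PlaneMove.reach_mono (s := α) (t := α * β)
        (dih p _ (nn _ (by rw [hp]; exact hne)) (nn _ (by rw [hq]; exact hne)) (hp.trans hq.symm))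
      have r3 : PlaneMove α α (α * β) (α * β, 0) (α * β, 0 + (α * (α * β) + α * β)) :=
        .inr (.inr rfl)
      have hr : planeNorm α (α * β, 0 + (α * (α * β) + α * β)) = α ^ 3 * β ^ 2 := by
        rw [step (α * β, 0), hq]
        linear_combination α ^ 2 * β ^ 2 * h2
      refine (r1.tail r3).trans (key _ (nn _ ?_) ?_)
      · rw [hr]; exact mul_ne_zero (pow_ne_zero _ hα) (pow_ne_zero _ hβ)
      · rw [hr]
        intro h
        apply hα1
        apply mul_left_cancel₀ hne
        linear_combination h
    have key3 : ∀ p : F × F, ReflTransGen (PlaneMove α α (α * β)) p (1, ζ⁻¹) := by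
      intro p
      by_cases hp : p = 0
      · subst hp
        refine ReflTransGen.head (b := (0, α * β)) (.inr (.inr (by simp))) (key2 _ ?_)
        simp [planeNorm, mul_pow]
      · by_cases h : planeNorm α p = α ^ 2 * β ^ 2
        · exact key2 p h
        · exact key p hp h
    exact fun p q => (key3 p).trans (PlaneMove.reach_symm (key3 q))
  · intro δ hδ hδα
    generalize hαd : ζ + ζ⁻¹ = α at *
    have key : ∀ p : F × F, p ≠ 0 → ReflTransGen (PlaneMove α δ 0) p (1, ζ⁻¹) := by
      intro p hp
      by_cases h0 : planeNorm α p = 0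
      · exact PlaneMove.reach_mono (dih p _ hp n0 (by rw [h0, n1]))
      have hε : δ * (δ + α) ≠ 0 := by
        refine mul_ne_zero hδ fun h => hδα ?_
        linear_combination h - α * h2
      obtain ⟨a, ha⟩ := exists_sq_eq (planeNorm α p / (δ * (δ + α)))
      have ha0 : a ≠ 0 := by
        rintro rfl
        exact div_ne_zero h0 hε (by rw [← ha]; simp)
      have hn : planeNorm α (a, a * ζ⁻¹ + (δ * a + 0)) = planeNorm α p := by
        have h1 := (null a ha0).2
        have h3 : planeNorm α p = a ^ 2 * (δ * (δ + α)) := by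
          rw [ha, div_mul_cancel₀ _ hε]
        rw [h3]
        simp only [planeNorm] at h1 ⊢
        linear_combination h1 + a * ζ⁻¹ * δ * a * h2
      have r1 := PlaneMove.reach_mono (s := δ) (t := 0)
        (dih p _ hp (nn _ (by rw [hn]; exact h0)) hn.symm)
      have r2 := PlaneMove.reach_mono (s := δ) (t := 0)
        (dih _ _ (null a ha0).1 n0 (by rw [(null a ha0).2, n1]))
      have r3 : PlaneMove α δ 0 (a, a * ζ⁻¹) (a, a * ζ⁻¹ + (δ * a + 0)) := .inr (.inr rfl)
      exact (r1.tail r3.symm).trans r2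
    exact fun p q hp hq => (key p hp).trans (PlaneMove.reach_symm (key q hq))


theorem isGoodParameter_of_card_four [CharP F 2] {ω : F} (hω : ω ^ 2 = ω + 1)
    (hF : ∀ x : F, x = 0 ∨ x = 1 ∨ x = ω ∨ x = ω + 1) : IsGoodParameter ω := by
  have h2 : (2 : F) = 0 := CharTwo.two_eq_zero
  have hω0 : ω ≠ 0 := by rintro rfl; simp at hω
  have hω1 : ω + 1 ≠ 0 := by rw [← hω]; exact pow_ne_zero _ hω0
  have inj : ∀ a b : F, a ^ 2 = b ^ 2 → a = b := fun a b h => by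
    have : (a + b) ^ 2 = 0 := by linear_combination h + (b ^ 2 + a * b) * h2
    have := pow_eq_zero_iff two_ne_zero |>.1 this
    linear_combination this - b * h2
  have chain : ∀ d : F,
      PlaneMove ω 0 0 (0, d) (ω * d, d) ∧ PlaneMove ω 0 0 (ω * d, d) (ω * d, ω * d) ∧
      PlaneMove ω 0 0 (ω * d, ω * d) (d, ω * d) ∧ PlaneMove ω 0 0 (d, ω * d) (d, 0) := by
    intro d
    refine ⟨.inr (.inl ?_), .inl ?_, .inr (.inl ?_), .inl ?_⟩ <;> ext <;> simp
    · linear_combination -d * hω - d * h2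
    · linear_combination -d * hω - ω * d * h2
    · linear_combination - ω * d * h2
  have c1 : ∀ d : F, ReflTransGen (PlaneMove ω 0 0) (ω * d, d) (0, d) := fun d =>
    PlaneMove.reach_symm (.single (chain d).1)
  have c2 : ∀ d : F, ReflTransGen (PlaneMove ω 0 0) (ω * d, ω * d) (0, d) := fun d =>
    .head (chain d).2.1.symm (c1 d)
  have c3 : ∀ d : F, ReflTransGen (PlaneMove ω 0 0) (d, ω * d) (0, d) := fun d =>
    .head (chain d).2.2.1.symm (c2 d)
  have c4 : ∀ d : F, ReflTransGen (PlaneMove ω 0 0) (d, 0) (0, d) := fun d =>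
    .head (chain d).2.2.2.symm (c3 d)
  have canon : ∀ p : F × F, p ≠ 0 → ∃ d : F, d ≠ 0 ∧ d ^ 2 = planeNorm ω p ∧
      ReflTransGen (PlaneMove ω 0 0) p (0, d) := by
    rintro ⟨a, b⟩ hp
    simp only [planeNorm]
    by_cases ha : a = 0
    · subst ha
      exact ⟨b, fun h => hp (by rw [h]; rfl), by ring, .refl⟩
    by_cases hb : b = 0
    · subst hb
      exact ⟨a, ha, by ring, c4 a⟩
    rcases hF (a / b) with h | h | h | h
    · exact absurd h (div_ne_zero ha hb)
    · rw [div_eq_iff hb] at h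
      have hd : a = ω * ((ω + 1) * a) := by linear_combination -a * hω - ω * a * h2
      refine ⟨(ω + 1) * a, mul_ne_zero hω1 ha, ?_, ?_⟩
      · rw [one_mul] at h
        subst h
        linear_combination a ^ 2 * hω + (ω * a ^ 2) * h2
      · have := c2 ((ω + 1) * a)
        rw [← hd] at this
        rwa [← show a = b by rw [h, one_mul]]
    · rw [div_eq_iff hb] at h
      subst h
      refine ⟨b, hb, ?_, c1 b⟩
      linear_combination -(ω ^ 2 * b ^ 2) * h2
    · rw [div_eq_iff hb] at h
      have hd : b = ω * a := by rw [h]; linear_combination -b * hω - ω * b * h2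
      subst hd
      refine ⟨a, ha, ?_, c3 a⟩
      linear_combination -(ω ^ 2 * a ^ 2) * h2
  have dih : ∀ p q : F × F, p ≠ 0 → q ≠ 0 → planeNorm ω p = planeNorm ω q →
      ReflTransGen (PlaneMove ω 0 0) p q := by
    intro p q hp hq hpq
    obtain ⟨d, -, hd, hpd⟩ := canon p hp
    obtain ⟨e, -, he, hqe⟩ := canon q hq
    have : d = e := inj d e (by rw [hd, he, hpq])
    subst this
    exact hpd.trans (PlaneMove.reach_symm hqe)
  have three : ∀ β d : F, β ≠ 0 → d ≠ 0 → d = β ∨ d = ω * β ∨ d = (ω + 1) * β := by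
    intro β d hβ hd
    rcases hF (d / β) with h | h | h | h
    · exact absurd h (div_ne_zero hd hβ)
    all_goals rw [div_eq_iff hβ] at h
    · left; simpa using h
    · right; left; exact h
    · right; right; exact h
  refine ⟨hω0, dih, ?_, ?_⟩
  · intro β hβ
    have mono := fun p q h => @PlaneMove.reach_mono F _ ω ω (ω * β) p q h
    have e1 : ReflTransGen (PlaneMove ω ω (ω * β)) (0, ω * β) (0, 0) :=
      .single (PlaneMove.symm (.inr (.inr (by simp))))
    have e2 : ReflTransGen (PlaneMove ω ω (ω * β)) (0, β) (0, ω * β) := by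
      refine (mono _ _ (PlaneMove.reach_symm (c1 β))).trans
        (ReflTransGen.trans ?_ (mono _ _ (c4 (ω * β))))
      refine .single (.inr (.inr ?_))
      ext <;> simp
      linear_combination -β * hω - (ω + 1) * β * h2
    have e3 : ReflTransGen (PlaneMove ω ω (ω * β)) (0, (ω + 1) * β) (0, ω * β) := by
      have k := mono _ _ (c1 (ω * β))
      refine (mono _ _ (PlaneMove.reach_symm (c3 ((ω + 1) * β)))).trans
        (ReflTransGen.trans ?_ k)
      refine .single (.inr (.inr ?_))
      ext <;> simp
      · linear_combination β * hω
      · linear_combination -2 * β * hω - (2 * ω * β + β) * h2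
    have key : ∀ p, ReflTransGen (PlaneMove ω ω (ω * β)) p (0, 0) := by
      intro p
      by_cases hp : p = 0
      · subst hp; exact .refl
      obtain ⟨d, hd, -, hpd⟩ := canon p hp
      refine (mono _ _ hpd).trans ?_
      rcases three β d hβ hd with rfl | rfl | rfl
      · exact e2.trans e1
      · exact e1
      · exact e3.trans e1
    exact fun p q => (key p).trans (PlaneMove.reach_symm (key q))
  · intro δ hδ hδω
    have mono := fun p q h => @PlaneMove.reach_mono F _ ω δ 0 p q h
    have e : ∀ d : F, ReflTransGen (PlaneMove ω δ 0) (0, d) (0, (ω + 1) * d) := by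
      intro d
      refine (mono _ _ (PlaneMove.reach_symm (c4 d))).trans ?_
      rcases hF δ with h | h | h | h
      · exact absurd h hδ
      · refine ReflTransGen.head (b := (d, d)) (.inr (.inr (by simp [h]))) ?_
        have k := mono _ _ (c2 ((ω + 1) * d))
        have hd : ω * ((ω + 1) * d) = d := by linear_combination d * hω + ω * d * h2
        rwa [hd] at k
      · exact absurd h hδω
      · refine ReflTransGen.head (b := (d, (ω + 1) * d)) (.inr (.inr (by simp [h]))) ?_
        have k := mono _ _ (c1 ((ω + 1) * d))
        have hd : ω * ((ω + 1) * d) = d := by linear_combination d * hω + ω * d * h2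
        rwa [hd] at k
    have e' : ∀ d : F, d ≠ 0 → ReflTransGen (PlaneMove ω δ 0) (0, d) (0, 1) := by
      intro d hd
      have k1 := e 1
      have k2 := e ((ω + 1) * 1)
      have hd' : (ω + 1) * ((ω + 1) * 1) = ω := by linear_combination hω + (ω + 1) * h2
      rw [hd'] at k2
      rw [mul_one] at k1 k2
      rcases hF d with h | h | h | h
      · exact absurd h hd
      · subst h; exact .refl
      · subst h; exact PlaneMove.reach_symm (k1.trans k2)
      · subst h; exact PlaneMove.reach_symm k1
    have key : ∀ p, p ≠ 0 → ReflTransGen (PlaneMove ω δ 0) p (0, 1) := by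
      intro p hp
      obtain ⟨d, hd, -, hpd⟩ := canon p hp
      exact (mono _ _ hpd).trans (e' d hd)
    exact fun p q hp hq => (key p hp).trans (PlaneMove.reach_symm (key q hq))

theorem exists_isGoodParameter [Fintype F] [CharP F 2] {k : ℕ} (hk : 2 ≤ k)
    (hF : Fintype.card F = 2 ^ k) : ∃ α : F, IsGoodParameter α := by
  classical
  have h2 : (2 : F) = 0 := CharTwo.two_eq_zero
  obtain ⟨g, hg⟩ := IsCyclic.exists_generator (α := Fˣ)
  have hgen : ∀ u : F, u ≠ 0 → ∃ j : ℕ, (g : F) ^ j = u := by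
    intro u hu
    obtain ⟨j, hj⟩ := mem_powers_iff_mem_zpowers.2 (hg (Units.mk0 u hu))
    exact ⟨j, by simpa using congrArg Units.val hj⟩
  have hcard : Fintype.card F ≤ orderOf g + 1 := by
    have h := orderOf_eq_card_of_forall_mem_zpowers hg
    rw [Nat.card_eq_fintype_card, Fintype.card_units] at h
    omega
  have hord : ∀ j : ℕ, 0 < j → (g : F) ^ j = 1 → Fintype.card F ≤ j + 1 := by
    intro j hj h
    have h1 : g ^ j = 1 := Units.ext (by simpa using h)
    have := orderOf_le_of_pow_eq_one hj h1
    omega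
  have hg0 : (g : F) ≠ 0 := g.ne_zero
  have h4 : 4 ≤ 2 ^ k := by simpa using Nat.pow_le_pow_right two_pos hk
  have hg1 : (g : F) ≠ 1 := by
    intro h
    have := hord 1 one_pos (by simpa using h)
    omega
  by_cases hq : (g : F) + (g : F)⁻¹ = 1
  · have hω : (g : F) ^ 2 = g + 1 := by
      have : (g : F) * (g : F)⁻¹ = 1 := mul_inv_cancel₀ hg0
      linear_combination (g : F) * hq - this - h2
    refine ⟨g, isGoodParameter_of_card_four ?_ ?_⟩
    · linear_combination hω
    intro x
    have h3 : (g : F) ^ 3 = 1 := by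
      linear_combination ((g : F) + 1) * hω + (g : F) * h2
    have hc := hord 3 three_pos h3
    have hx : x ^ 4 = x := by
      have := FiniteField.pow_card x
      rwa [show Fintype.card F = 4 by omega] at this
    have : x * ((x - 1) * ((x - g) * (x - (g + 1)))) = 0 := by
      linear_combination hx + (x ^ 2 - x) * hω +
        (- x ^ 3 - g * x ^ 3 + 2 * g * x ^ 2 + x ^ 2 - x * g) * h2
    rcases mul_eq_zero.1 this with h | h
    · exact .inl h
    rcases mul_eq_zero.1 h with h | h
    · exact .inr (.inl (sub_eq_zero.1 h))
    rcases mul_eq_zero.1 h with h | h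
    · exact .inr (.inr (.inl (sub_eq_zero.1 h)))
    · exact .inr (.inr (.inr (sub_eq_zero.1 h)))
  · refine ⟨_, isGoodParameter_hyperbolic hg0 (fun h => hg1 ?_) hq hgen⟩
    have hi : (g : F) * (g : F)⁻¹ = 1 := mul_inv_cancel₀ hg0
    have : ((g : F) + 1) ^ 2 = 0 := by linear_combination (g : F) * h - hi + (g : F) * h2
    have := pow_eq_zero_iff two_ne_zero |>.1 this
    linear_combination this - h2

end PlaneMoves

section Transvections

variable {F V G : Type*} [Field F] [AddCommGroup V] [Module F V] [Group G] [DistribMulAction G V]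

/-- The group `G` acts faithfully and linearly on `V`, preserves the nondegenerate alternating form
`B`, and `T v` acts as the transvection `x ↦ x + B x v • v`. -/
structure IsTransvectionGroup (B : V →ₗ[F] V →ₗ[F] F) (T : V → G) : Prop where
  self : ∀ x, B x x = 0
  nondeg : ∀ x, (∀ y, B x y = 0) → x = 0
  smul_comm_scalar : ∀ (g : G) (c : F) (x : V), g • c • x = c • g • x
  faithful : ∀ g : G, (∀ x : V, g • x = x) → g = 1
  invariant : ∀ (g : G) (x y : V), B (g • x) (g • y) = B x y
  smul_eq : ∀ v x, T v • x = x + B x v • v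

/-- `Q` is a quadratic form with polar form `B`. -/
structure IsQuadraticForm (B : V →ₗ[F] V →ₗ[F] F) (Q : V → F) : Prop where
  map_add : ∀ x y, Q (x + y) = Q x + Q y + B x y
  map_smul : ∀ (c : F) (x : V), Q (c • x) = c ^ 2 * Q x

/-- Some element of `H` maps `x` to `y`. -/
def Reach (H : Subgroup G) (x y : V) : Prop := ∃ g ∈ H, g • x = y

theorem Reach.refl (H : Subgroup G) (x : V) : Reach H x x := ⟨1, H.one_mem, one_smul _ _⟩

theorem Reach.trans {H : Subgroup G} {x y z : V} (h : Reach H x y) (h' : Reach H y z) :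
    Reach H x z := by
  obtain ⟨g, hg, rfl⟩ := h
  obtain ⟨g', hg', rfl⟩ := h'
  exact ⟨g' * g, H.mul_mem hg' hg, mul_smul _ _ _⟩

theorem Reach.symm {H : Subgroup G} {x y : V} (h : Reach H x y) : Reach H y x := by
  obtain ⟨g, hg, rfl⟩ := h
  exact ⟨g⁻¹, H.inv_mem hg, inv_smul_smul _ _⟩

theorem Reach.mono {H K : Subgroup G} (hHK : H ≤ K) {x y : V} (h : Reach H x y) :
    Reach K x y := by
  obtain ⟨g, hg, rfl⟩ := h
  exact ⟨g, hHK hg, rfl⟩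

theorem exists_of_reflTransGen {X P : Type*} {S : X → Prop} {c : X → P} {r : P → P → Prop}
    (hS : ∀ x q, S x → r (c x) q → ∃ y, S y ∧ c y = q) {x : X} {q : P} (hx : S x)
    (h : Relation.ReflTransGen r (c x) q) : ∃ y, S y ∧ c y = q := by
  induction h with
  | refl => exact ⟨x, hx, rfl⟩
  | tail _ h ih =>
    obtain ⟨y, hy, rfl⟩ := ih
    exact hS y _ hy h

namespace IsTransvectionGroup

variable {B : V →ₗ[F] V →ₗ[F] F} {T : V → G} {Q : V → F}

theorem form_comm [CharP F 2] (hT : IsTransvectionGroup B T) (x y : V) : B x y = B y x := by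
  have h := hT.self (x + y)
  simp only [map_add, LinearMap.add_apply, hT.self] at h
  have h2 : (2 : F) = 0 := CharTwo.two_eq_zero
  linear_combination h - B y x * h2

theorem reach_step (hT : IsTransvectionGroup B T) {H : Subgroup G} {v : V} (hv : T v ∈ H)
    (x : V) : Reach H x (x + B x v • v) := ⟨T v, hv, hT.smul_eq v x⟩

theorem reach_pair [CharP F 2] (hT : IsTransvectionGroup B T) (hQ : IsQuadraticForm B Q) {α : F}
    (hα : IsGoodParameter α) {H : Subgroup G} {a b : V} (ha : T a ∈ H) (hb : T b ∈ H)
    (hab : B a b = α) (hQa : Q a = 1) (hQb : Q b = 1) {x : V} (c d : F)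
    (hx : B x a ≠ 0 ∨ B x b ≠ 0)
    (hx' : B (x + c • a + d • b) a ≠ 0 ∨ B (x + c • a + d • b) b ≠ 0)
    (hQx : Q (x + c • a + d • b) = Q x) : Reach H x (x + c • a + d • b) := by
  have h2 : (2 : F) = 0 := CharTwo.two_eq_zero
  have hba : B b a = α := by rw [hT.form_comm, hab]
  have haa := hT.self a
  have hbb := hT.self b
  have hQ' := hQx
  simp only [hQ.map_add, hQ.map_smul, map_add, LinearMap.add_apply, map_smul, LinearMap.smul_apply,
    smul_eq_mul, hab, hQa, hQb] at hQ'
  have key := exists_of_reflTransGen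
    (S := fun z => Reach H x z ∧ ∃ c d : F, z = x + c • a + d • b)
    (c := fun z => (B z a, B z b)) (r := PlaneMove α 0 0) (x := x)
    (q := (B (x + c • a + d • b) a, B (x + c • a + d • b) b)) ?_
    ⟨Reach.refl H x, 0, 0, by simp⟩ ?_
  · obtain ⟨z, ⟨hz, c', d', rfl⟩, hz'⟩ := key
    simp only [map_add, LinearMap.add_apply, map_smul, LinearMap.smul_apply, smul_eq_mul, haa, hbb,
      hab, hba, Prod.mk.injEq] at hz'
    have e1 : c' = c := mul_right_cancel₀ hα.ne_zero (by linear_combination hz'.2)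
    have e2 : d' = d := mul_right_cancel₀ hα.ne_zero (by linear_combination hz'.1)
    rwa [e1, e2] at hz
  · rintro z q ⟨hz, c, d, rfl⟩ (rfl | rfl | rfl)
    · refine ⟨_, ⟨hz.trans (hT.reach_step ha _), c + B (x + c • a + d • b) a, d, by module⟩, ?_⟩
      simp only [map_add, LinearMap.add_apply, map_smul, LinearMap.smul_apply, smul_eq_mul, haa,
        hbb, hab, hba, Prod.mk.injEq]
      constructor <;> ring
    · refine ⟨_, ⟨hz.trans (hT.reach_step hb _), c, d + B (x + c • a + d • b) b, by module⟩, ?_⟩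
      simp only [map_add, LinearMap.add_apply, map_smul, LinearMap.smul_apply, smul_eq_mul, haa,
        hbb, hab, hba, Prod.mk.injEq]
      constructor <;> ring
    · exact ⟨_, ⟨hz, c, d, rfl⟩, by simp⟩
  · apply hα.dihedral
    · simpa [Prod.ext_iff, ← not_and_or] using hx
    · intro h
      rw [Prod.ext_iff] at h
      exact hx'.elim (· h.1) (· h.2)
    · simp only [planeNorm, map_add, LinearMap.add_apply, map_smul, LinearMap.smul_apply,
        smul_eq_mul, haa, hbb, hab, hba]
      linear_combination - α ^ 2 * hQ' - (α * d * B x a + α * c * B x b) * h2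

theorem reach_triple [CharP F 2] (hT : IsTransvectionGroup B T) (hQ : IsQuadraticForm B Q) {α : F}
    (hα : IsGoodParameter α) {H : Subgroup G} {e₀ e₁ e₂ : V} (h₀ : T e₀ ∈ H) (h₁ : T e₁ ∈ H)
    (h₂ : T e₂ ∈ H) (h₀₁ : B e₀ e₁ = α) (h₁₂ : B e₁ e₂ = α) (h₀₂ : B e₀ e₂ = 0)
    (hQ₀ : Q e₀ = 1) (hQ₂ : Q e₂ = 1) {x : V} (c₀ c₁ c₂ : F) (hx : B x e₀ + B x e₂ ≠ 0)
    (hQx : Q (x + c₀ • e₀ + c₁ • e₁ + c₂ • e₂) = Q x) (hQH : ∀ g ∈ H, ∀ x, Q (g • x) = Q x) :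
    Reach H x (x + c₀ • e₀ + c₁ • e₁ + c₂ • e₂) := by
  have h2 : (2 : F) = 0 := CharTwo.two_eq_zero
  have h₁₀ : B e₁ e₀ = α := by rw [hT.form_comm, h₀₁]
  have h₂₁ : B e₂ e₁ = α := by rw [hT.form_comm, h₁₂]
  have h₂₀ : B e₂ e₀ = 0 := by rw [hT.form_comm, h₀₂]
  have s₀ := hT.self e₀
  have s₁ := hT.self e₁
  have s₂ := hT.self e₂
  set β := B x e₀ + B x e₂ with hβ
  have key := exists_of_reflTransGen
    (S := fun z => Reach H x z ∧ B z e₀ + B z e₂ = β ∧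
      ∃ c₀ c₁ c₂ : F, z = x + c₀ • e₀ + c₁ • e₁ + c₂ • e₂)
    (c := fun z => (B z e₀, B z e₁)) (r := PlaneMove α α (α * β)) (x := x)
    (q := (B (x + c₀ • e₀ + c₁ • e₁ + c₂ • e₂) e₀, B (x + c₀ • e₀ + c₁ • e₁ + c₂ • e₂) e₁)) ?_
    ⟨Reach.refl H x, rfl, 0, 0, 0, by simp⟩ (hα.affine β hx _ _)
  · obtain ⟨z, ⟨hz, -, d₀, d₁, d₂, rfl⟩, hz'⟩ := key
    have hQ' : Q (x + d₀ • e₀ + d₁ • e₁ + d₂ • e₂) = Q (x + c₀ • e₀ + c₁ • e₁ + c₂ • e₂) := by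
      obtain ⟨g, hg, h⟩ := hz
      rw [← h, hQH g hg, hQx]
    simp only [hQ.map_add, hQ.map_smul, map_add, LinearMap.add_apply, map_smul,
      LinearMap.smul_apply, smul_eq_mul, s₀, s₁, h₀₁, h₁₀, h₁₂, h₂₁, h₀₂, h₂₀, hQ₀, hQ₂,
      Prod.mk.injEq] at hz' hQ'
    have e1 : d₁ = c₁ := mul_right_cancel₀ hα.ne_zero (by linear_combination hz'.1)
    have e2 : d₂ = c₀ + c₂ - d₀ := mul_right_cancel₀ hα.ne_zero (by linear_combination hz'.2)
    subst e1 e2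
    have e3 : d₀ = c₀ := by
      refine mul_right_cancel₀ hx ?_
      rw [hβ]
      linear_combination hQ' + ((d₀ - c₀) * B x e₂ - (d₀ - c₀) * d₀ + c₂ * (d₀ - c₀)) * h2
    subst e3
    rwa [add_sub_cancel_left] at hz
  · rintro z q ⟨hz, hzβ, c₀, c₁, c₂, rfl⟩ (rfl | rfl | rfl)
    · refine ⟨_, ⟨hz.trans (hT.reach_step h₀ _), ?_, c₀ + B (x + c₀ • e₀ + c₁ • e₁ + c₂ • e₂) e₀,
        c₁, c₂, by module⟩, ?_⟩
      · simpa [s₀, h₀₂] using hzβ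
      · simp [s₀, h₀₁]; ring
    · refine ⟨_, ⟨hz.trans (hT.reach_step h₁ _), ?_, c₀,
        c₁ + B (x + c₀ • e₀ + c₁ • e₁ + c₂ • e₂) e₁, c₂, by module⟩, ?_⟩
      · rw [map_add, map_smul]
        simp only [LinearMap.add_apply (B (x + c₀ • e₀ + c₁ • e₁ + c₂ • e₂)),
          LinearMap.smul_apply, h₁₀, h₁₂, smul_eq_mul]
        linear_combination hzβ + B (x + c₀ • e₀ + c₁ • e₁ + c₂ • e₂) e₁ * α * h2
      · rw [map_add, map_smul]
        simp only [LinearMap.add_apply (B (x + c₀ • e₀ + c₁ • e₁ + c₂ • e₂)),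
          LinearMap.smul_apply, h₁₀, s₁, smul_eq_mul, Prod.mk.injEq]
        constructor <;> ring
    · refine ⟨_, ⟨hz.trans (hT.reach_step h₂ _), ?_, c₀, c₁,
        c₂ + B (x + c₀ • e₀ + c₁ • e₁ + c₂ • e₂) e₂, by module⟩, ?_⟩
      · rw [map_add, map_smul]
        simp only [LinearMap.add_apply (B (x + c₀ • e₀ + c₁ • e₁ + c₂ • e₂)),
          LinearMap.smul_apply, h₂₀, s₂, smul_eq_mul]
        linear_combination hzβ
      · rw [map_add, map_smul]
        simp only [LinearMap.add_apply (B (x + c₀ • e₀ + c₁ • e₁ + c₂ • e₂)),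
          LinearMap.smul_apply, h₂₀, h₂₁, smul_eq_mul, Prod.mk.injEq]
        constructor
        · ring
        · rw [← hzβ]
          linear_combination -(α * B (x + c₀ • e₀ + c₁ • e₁ + c₂ • e₂) e₀) * h2

/-- Kill the coefficient of `e₀` and the pairing with `e₁`. -/
theorem exists_reach_kill [Finite F] [CharP F 2] (hT : IsTransvectionGroup B T)
    (hQ : IsQuadraticForm B Q) {α : F} (hα : IsGoodParameter α) {H : Subgroup G} {e₀ e₁ e₂ : V}
    (h₀ : T e₀ ∈ H) (h₁ : T e₁ ∈ H) (h₂ : T e₂ ∈ H) (h₀₁ : B e₀ e₁ = α) (h₁₂ : B e₁ e₂ = α)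
    (h₀₂ : B e₀ e₂ = 0) (hQ₀ : Q e₀ = 1) (hQ₁ : Q e₁ = 1) (hQ₂ : Q e₂ = 1) {x : V} (c : F)
    (hx : B x e₀ + B x e₂ ≠ 0) (hQH : ∀ g ∈ H, ∀ x, Q (g • x) = Q x) :
    ∃ r s : F, Reach H x (x + c • e₀ + r • e₁ + s • e₂) ∧
      B (x + c • e₀ + r • e₁ + s • e₂) e₁ = 0 := by
  have h2 : (2 : F) = 0 := CharTwo.two_eq_zero
  have h₂₁ : B e₂ e₁ = α := by rw [hT.form_comm, h₁₂]
  have s₁ := hT.self e₁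
  obtain ⟨s, hs⟩ : ∃ s : F, α * s = α * c + B x e₁ :=
    ⟨c + B x e₁ / α, by rw [mul_add, mul_div_cancel₀ _ hα.ne_zero]⟩
  obtain ⟨r, hr⟩ := exists_sq_eq (c * B x e₀ + s * B x e₂ + c ^ 2 + s ^ 2)
  refine ⟨r, s, hT.reach_triple hQ hα h₀ h₁ h₂ h₀₁ h₁₂ h₀₂ hQ₀ hQ₂ c r s hx ?_ hQH, ?_⟩
  · simp only [hQ.map_add, hQ.map_smul, map_add, LinearMap.add_apply, map_smul,
      LinearMap.smul_apply, smul_eq_mul, h₀₁, h₁₂, h₀₂, hQ₀, hQ₁, hQ₂]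
    linear_combination hr + r * hs +
      (c * B x e₀ + s * B x e₂ + c ^ 2 + s ^ 2 + α * c * r + r * B x e₁) * h2
  · simp only [map_add, LinearMap.add_apply, map_smul, LinearMap.smul_apply, smul_eq_mul, h₀₁, h₂₁,
      s₁]
    linear_combination hs + (α * c + B x e₁) * h2

/-- A vector pairing nontrivially only with the first vector of a path of length five can be moved
so that it pairs nontrivially with the last one. -/
theorem exists_reach_last [Finite F] [CharP F 2] (hT : IsTransvectionGroup B T)
    (hQ : IsQuadraticForm B Q) {α : F} (hα : IsGoodParameter α) (ht : ∃ t : F, t ≠ 0 ∧ t ≠ 1)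
    {H : Subgroup G} {e₀ e₁ e₂ e₃ e₄ : V}
    (h₀ : T e₀ ∈ H) (h₁ : T e₁ ∈ H) (h₂ : T e₂ ∈ H) (h₃ : T e₃ ∈ H)
    (h₀₁ : B e₀ e₁ = α) (h₁₂ : B e₁ e₂ = α) (h₂₃ : B e₂ e₃ = α) (h₃₄ : B e₃ e₄ = α)
    (h₀₂ : B e₀ e₂ = 0) (h₀₃ : B e₀ e₃ = 0) (h₁₃ : B e₁ e₃ = 0)
    (h₁₄ : B e₁ e₄ = 0)
    (hQ₀ : Q e₀ = 1) (hQ₁ : Q e₁ = 1) (hQ₂ : Q e₂ = 1) (hQ₃ : Q e₃ = 1) {x : V}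
    (hx₀ : B x e₀ ≠ 0) (hx₁ : B x e₁ = 0) (hx₂ : B x e₂ = 0) (hx₃ : B x e₃ = 0) (hx₄ : B x e₄ = 0)
    (hQH : ∀ g ∈ H, ∀ x, Q (g • x) = Q x) :
    ∃ r s : F, Reach H x (x + r • e₁ + s • e₃) ∧ B (x + r • e₁ + s • e₃) e₄ ≠ 0 := by
  have h2 : (2 : F) = 0 := CharTwo.two_eq_zero
  have h₁₀ : B e₁ e₀ = α := by rw [hT.form_comm, h₀₁]
  have h₂₁ : B e₂ e₁ = α := by rw [hT.form_comm, h₁₂]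
  have h₃₂ : B e₃ e₂ = α := by rw [hT.form_comm, h₂₃]
  have h₂₀ : B e₂ e₀ = 0 := by rw [hT.form_comm, h₀₂]
  have h₃₀ : B e₃ e₀ = 0 := by rw [hT.form_comm, h₀₃]
  have h₃₁ : B e₃ e₁ = 0 := by rw [hT.form_comm, h₁₃]
  have s₀ := hT.self e₀
  have s₁ := hT.self e₁
  have s₂ := hT.self e₂
  have s₃ := hT.self e₃
  have hα0 := hα.ne_zero
  obtain ⟨t, ht0, ht1⟩ := ht
  generalize hβ : B x e₀ = β at hx₀
  obtain ⟨s, hs⟩ : ∃ s : F, α * s = t * β := ⟨t * β / α, mul_div_cancel₀ _ hα0⟩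
  have hs0 : α * s ≠ 0 := hs ▸ mul_ne_zero ht0 hx₀
  obtain ⟨u, hu⟩ := exists_sq_eq (β ^ 2 + s ^ 2 + α * β * s)
  obtain ⟨r, hr⟩ := exists_sq_eq (β ^ 2 + α * β * s)
  have m₁ : Reach H x (x + β • e₀) := hβ ▸ hT.reach_step h₀ x
  have m₂ : Reach H (x + β • e₀) (x + β • e₀ + u • e₁ + β • e₂ + s • e₃) := by
    refine hT.reach_triple hQ hα h₁ h₂ h₃ h₁₂ h₂₃ h₁₃ hQ₁ hQ₃ u β s ?_ ?_ hQH
    · simp [hx₁, hx₃, h₀₁, h₀₃, hx₀, hα0]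
    · simp only [hQ.map_add, hQ.map_smul, map_add, LinearMap.add_apply, map_smul,
        LinearMap.smul_apply, smul_eq_mul, h₀₁, h₀₂, h₀₃, h₁₂, h₂₃, h₁₃, hQ₀, hQ₁, hQ₂, hQ₃, hx₁,
        hx₂, hx₃]
      linear_combination hu + (u * α * β + β ^ 2 + s ^ 2 + α * β * s) * h2
  have m₃ : Reach H (x + β • e₀ + u • e₁ + β • e₂ + s • e₃)
      (x + β • e₀ + u • e₁ + β • e₂ + s • e₃ + β • e₀ + r • e₁ + β • e₂) := by
    refine hT.reach_triple hQ hα h₀ h₁ h₂ h₀₁ h₁₂ h₀₂ hQ₀ hQ₂ β r β ?_ ?_ hQH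
    · simp only [map_add, LinearMap.add_apply, map_smul, LinearMap.smul_apply, smul_eq_mul, s₀, s₂,
        h₁₀, h₂₀, h₃₀, h₀₂, h₁₂, h₃₂, hx₂, hβ]
      intro h
      have : (t - 1) * β = 0 := by linear_combination h - hs - (α * u + β) * h2
      exact (mul_ne_zero (sub_ne_zero.2 ht1) hx₀) this
    · simp only [hQ.map_add, hQ.map_smul, map_add, LinearMap.add_apply, map_smul,
        LinearMap.smul_apply, smul_eq_mul, s₀, s₁, s₂, h₀₁, h₁₀, h₂₀, h₃₀, h₂₁, h₃₁, h₃₂, h₀₂, h₁₂,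
        hQ₀, hQ₁, hQ₂, hQ₃, hx₁, hx₂, hβ]
      linear_combination hr + (2 * β ^ 2 + α * β * u + α * β * s + 2 * α * β * r) * h2
  have e : x + β • e₀ + u • e₁ + β • e₂ + s • e₃ + β • e₀ + r • e₁ + β • e₂ =
      x + (u + r) • e₁ + s • e₃ := by
    have : x + β • e₀ + u • e₁ + β • e₂ + s • e₃ + β • e₀ + r • e₁ + β • e₂ =
        x + (u + r) • e₁ + s • e₃ + ((2 : F) * β) • e₀ + ((2 : F) * β) • e₂ := by module
    rw [this, h2, zero_mul, zero_smul, zero_smul, add_zero, add_zero]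
  refine ⟨u + r, s, e ▸ (m₁.trans m₂).trans m₃, ?_⟩
  simpa [hx₄, h₁₄, h₃₄, hα0] using hs0

end IsTransvectionGroup
end Transvections

section Paths

variable {F V G : Type*} [Field F] [AddCommGroup V] [Module F V] [Group G] [DistribMulAction G V]

/-- The vectors `v 0, …, v (N - 1)` form a path with edges labelled by a good parameter `α`, they
have norm one for the quadratic form `Q`, and `y` is a triangular dual system. -/
structure IsPath (B : V →ₗ[F] V →ₗ[F] F) (Q : V → F) (α : F) (v y : ℕ → V) (N : ℕ) : Prop where
  quadratic : IsQuadraticForm B Q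
  good : IsGoodParameter α
  exists_ne : ∃ t : F, t ≠ 0 ∧ t ≠ 1
  adj : ∀ i, i + 1 < N → B (v i) (v (i + 1)) = α
  far : ∀ i j, i + 1 < j → j < N → B (v i) (v j) = 0
  norm : ∀ i, i < N → Q (v i) = 1
  dual_zero : ∀ j b, j < b → b < N → B (y b) (v j) = 0
  dual_ne : ∀ b, b < N → B (y b) (v b) ≠ 0

/-- The subgroup generated by the transvections along the vectors `v i`, for `i ∈ I`. -/
def pathGroup (T : V → G) (v : ℕ → V) (I : Set ℕ) : Subgroup G :=
  Subgroup.closure ((fun i => T (v i)) '' I)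

theorem mem_pathGroup {V G : Type*} [Group G] (T : V → G) (v : ℕ → V) {I : Set ℕ} {i : ℕ}
    (hi : i ∈ I) :
    T (v i) ∈ pathGroup T v I :=
  Subgroup.subset_closure ⟨i, hi, rfl⟩

theorem pathGroup_mono {V G : Type*} [Group G] (T : V → G) (v : ℕ → V) {I J : Set ℕ} (h : I ⊆ J) :
    pathGroup T v I ≤ pathGroup T v J :=
  Subgroup.closure_mono (Set.image_mono h)

open Submodule

theorem exists_of_mem_span_Icc {v : ℕ → V} {a b : ℕ} (hab : a ≤ b) {x : V}
    (hx : x ∈ span F (v '' Set.Icc a b)) :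
    ∃ c : F, ∃ w ∈ span F (v '' Set.Icc (a + 1) b), x = c • v a + w := by
  have : Set.Icc a b = insert a (Set.Icc (a + 1) b) := by
    ext i; simp only [Set.mem_Icc, Set.mem_insert_iff]; omega
  rw [this, Set.image_insert_eq, mem_span_insert] at hx
  exact hx

theorem exists_of_mem_span_Ico_succ {v : ℕ → V} {a b : ℕ} (hab : a ≤ b) {x : V}
    (hx : x ∈ span F (v '' Set.Ico a (b + 1))) :
    ∃ c : F, ∃ w ∈ span F (v '' Set.Ico a b), x = c • v b + w := by
  have : Set.Ico a (b + 1) = insert b (Set.Ico a b) := by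
    ext i; simp only [Set.mem_Ico, Set.mem_insert_iff]; omega
  rw [this, Set.image_insert_eq, mem_span_insert] at hx
  exact hx

theorem mem_span_image {v : ℕ → V} {I : Set ℕ} {i : ℕ} (hi : i ∈ I) : v i ∈ span F (v '' I) :=
  subset_span ⟨i, hi, rfl⟩

namespace IsTransvectionGroup

variable {B : V →ₗ[F] V →ₗ[F] F} {T : V → G} {Q : V → F}

theorem mul_self_eq_one [CharP F 2] (hT : IsTransvectionGroup B T) (v : V) : T v * T v = 1 := by
  refine hT.faithful _ fun x => ?_
  have h2 : (2 : F) = 0 := CharTwo.two_eq_zero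
  rw [mul_smul, hT.smul_eq v x, hT.smul_eq]
  simp only [map_add, LinearMap.add_apply, map_smul, LinearMap.smul_apply, smul_eq_mul, hT.self]
  have : x + B x v • v + (B x v + B x v * 0) • v = x + ((2 : F) * B x v) • v := by module
  rw [this, h2, zero_mul, zero_smul, add_zero]

theorem conj_eq (hT : IsTransvectionGroup B T) (g : G) (v : V) :
    g * T v * g⁻¹ = T (g • v) := by
  have : T (g • v) * g = g * T v := by
    have := hT.faithful ((T (g • v) * g)⁻¹ * (g * T v)) fun x => by
      rw [mul_smul, inv_smul_eq_iff, mul_smul, mul_smul, hT.smul_eq, hT.smul_eq, hT.invariant,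
        smul_add, hT.smul_comm_scalar]
    exact (inv_mul_eq_one.1 this)
  rw [← this, mul_inv_cancel_right]

theorem commute (hT : IsTransvectionGroup B T) {u v : V} (h : B v u = 0) :
    Commute (T u) (T v) := by
  have := hT.conj_eq (T u) v
  rwa [hT.smul_eq, h, zero_smul, add_zero, mul_inv_eq_iff_eq_mul] at this

theorem map_smul_eq [CharP F 2] (hT : IsTransvectionGroup B T) (hQ : IsQuadraticForm B Q) {v : V}
    (hv : Q v = 1) (x : V) : Q (T v • x) = Q x := by
  have h2 : (2 : F) = 0 := CharTwo.two_eq_zero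
  rw [hT.smul_eq, hQ.map_add, hQ.map_smul, hv, map_smul, smul_eq_mul]
  linear_combination B x v ^ 2 * h2

theorem pathGroup_preserves [CharP F 2] (hT : IsTransvectionGroup B T) (hQ : IsQuadraticForm B Q)
    {v : ℕ → V} {I : Set ℕ} (hI : ∀ i ∈ I, Q (v i) = 1) {g : G} (hg : g ∈ pathGroup T v I) :
    ∀ x, Q (g • x) = Q x := by
  induction hg using Subgroup.closure_induction with
  | mem g hg =>
    obtain ⟨i, hi, rfl⟩ := hg
    exact hT.map_smul_eq hQ (hI i hi)
  | one => simp
  | mul g h _ _ hg hh => intro x; rw [mul_smul, hg, hh]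
  | inv g _ hg => intro x; rw [← hg, smul_inv_smul]

theorem pathGroup_sub_mem (hT : IsTransvectionGroup B T) {v : ℕ → V} {I : Set ℕ} {g : G}
    (hg : g ∈ pathGroup T v I) : ∀ x, g • x - x ∈ span F (v '' I) := by
  induction hg using Subgroup.closure_induction with
  | mem g hg =>
    obtain ⟨i, hi, rfl⟩ := hg
    intro x
    simp only [hT.smul_eq, add_sub_cancel_left]
    exact smul_mem _ _ (mem_span_image hi)
  | one => simp
  | mul g h _ _ hg hh =>
    intro x
    rw [mul_smul, ← sub_add_sub_cancel]
    exact add_mem (hg _) (hh _)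
  | inv g _ hg =>
    intro x
    have := neg_mem (hg (g⁻¹ • x))
    rwa [smul_inv_smul, neg_sub] at this

/-- A nonzero pairing can be moved along the path. -/
theorem exists_reach_pairing_ne [CharP F 2] (hT : IsTransvectionGroup B T) {α : F} {v y : ℕ → V}
    {N : ℕ} (hP : IsPath B Q α v y N) {a b : ℕ} (hb : b < N) {x : V} {i j : ℕ} (hai : a ≤ i)
    (hib : i ≤ b) (haj : a ≤ j) (hjb : j ≤ b) (hx : B x (v i) ≠ 0) :
    ∃ x', Reach (pathGroup T v (Set.Icc a b)) x x' ∧ B x' (v j) ≠ 0 := by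
  have step : ∀ x i j, a ≤ i → i ≤ b → j < N → B (v i) (v j) ≠ 0 → B x (v i) ≠ 0 →
      ∃ x', Reach (pathGroup T v (Set.Icc a b)) x x' ∧ B x' (v j) ≠ 0 := by
    intro x i j hai hib _ hij hx
    by_cases h : B x (v j) = 0
    · refine ⟨_, hT.reach_step (mem_pathGroup T v (I := Set.Icc a b) ⟨hai, hib⟩) x, ?_⟩
      simp [h, hx, hij]
    · exact ⟨x, Reach.refl _ _, h⟩
  rcases le_total i j with h | h
  · induction j, h using Nat.le_induction with
    | base => exact ⟨x, Reach.refl _ _, hx⟩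
    | succ j hij ih =>
      obtain ⟨x', h1, h2⟩ := ih (by omega) (by omega)
      obtain ⟨x'', h3, h4⟩ := step x' j (j + 1) (by omega) (by omega) (by omega)
        (by rw [hP.adj j (by omega)]; exact hP.good.ne_zero) h2
      exact ⟨x'', h1.trans h3, h4⟩
  · induction h using Nat.decreasingInduction with
    | self => exact ⟨x, Reach.refl _ _, hx⟩
    | of_succ j hij ih =>
      obtain ⟨x', h1, h2⟩ := ih (by omega) (by omega)
      obtain ⟨x'', h3, h4⟩ := step x' (j + 1) j (by omega) (by omega) (by omega)
        (by rw [hT.form_comm, hP.adj j (by omega)]; exact hP.good.ne_zero) h2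
      exact ⟨x'', h1.trans h3, h4⟩

theorem sub_mem_span_trans {S : Submodule F V} {x x' y : V} (h : x' - x ∈ S) (hxy : x - y ∈ S) :
    x' - y ∈ S := by
  rw [← sub_add_sub_cancel x' x y]
  exact add_mem h hxy

/-- A vector which is not fixed by the group of a subpath ending at `b` is moved by this group to
the dual vector `y b` as soon as this is not excluded by the obvious invariants. -/
theorem reach_dual [Finite F] [CharP F 2] (hT : IsTransvectionGroup B T) {α : F} {v y : ℕ → V}
    {N : ℕ} (hP : IsPath B Q α v y N) {b : ℕ} (hb : b < N) (n : ℕ) :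
    ∀ a, a + n = b → ∀ x, x - y b ∈ span F (v '' Set.Icc a b) → Q x = Q (y b) →
      (∃ j ∈ Set.Icc a b, B x (v j) ≠ 0) → Reach (pathGroup T v (Set.Icc a b)) x (y b) := by
  have h2 : (2 : F) = 0 := CharTwo.two_eq_zero
  have hQ := hP.quadratic
  have hα := hP.good
  have hα0 := hα.ne_zero
  have hyb := hP.dual_ne b hb
  have hempty : ∀ w, w ∈ span F (v '' Set.Icc (b + 1) b) → w = 0 := by
    intro w hw
    simpa using hw
  have hpres : ∀ a, ∀ g ∈ pathGroup T v (Set.Icc a b), ∀ x, Q (g • x) = Q x := fun a g hg =>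
    hT.pathGroup_preserves hQ (fun i hi => hP.norm i (lt_of_le_of_lt hi.2 hb)) hg
  have hinv : ∀ a x x', Reach (pathGroup T v (Set.Icc a b)) x x' →
      x - y b ∈ span F (v '' Set.Icc a b) → Q x = Q (y b) →
      x' - y b ∈ span F (v '' Set.Icc a b) ∧ Q x' = Q (y b) := by
    rintro a x _ ⟨g, hg, rfl⟩ h h'
    exact ⟨sub_mem_span_trans (hT.pathGroup_sub_mem hg x) h, (hpres a g hg x).trans h'⟩
  induction n with
  | zero =>
    rintro a rfl x hx hQx -
    obtain ⟨c, w, hw, hxw⟩ := exists_of_mem_span_Icc le_rfl hx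
    rw [hempty w hw, add_zero, sub_eq_iff_eq_add'] at hxw
    subst hxw
    simp only [add_zero] at *
    rw [hQ.map_add, hQ.map_smul, hP.norm _ hb, map_smul, smul_eq_mul] at hQx
    have : c * (c - B (y a) (v a)) = 0 := by
      linear_combination hQx - c * B (y a) (v a) * h2
    rcases mul_eq_zero.1 this with h | h
    · rw [h, zero_smul, add_zero]; exact Reach.refl _ _
    · rw [sub_eq_zero.1 h]
      exact (hT.reach_step (mem_pathGroup T v (I := Set.Icc a a) (by simp)) _).symm
  | succ n ih =>
    rintro a hab x hx hQx hj
    have hmem : ∀ i, a ≤ i → i ≤ b → T (v i) ∈ pathGroup T v (Set.Icc a b) := fun i h h' =>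
      mem_pathGroup T v ⟨h, h'⟩
    obtain rfl | rfl | ⟨n, rfl⟩ : n = 0 ∨ n = 1 ∨ ∃ k, n = k + 2 := by
      rcases n with _ | _ | n
      · simp
      · simp
      · exact .inr (.inr ⟨n, rfl⟩)
    · obtain ⟨c, w, hw, hxw⟩ := exists_of_mem_span_Icc (by omega) hx
      obtain ⟨d, z, hz, rfl⟩ := exists_of_mem_span_Icc (by omega) hw
      obtain rfl : b = a + 1 := by omega
      rw [hempty z hz, add_zero, sub_eq_iff_eq_add', ← add_assoc] at hxw
      subst hxw
      refine (hT.reach_pair hQ hα (hmem _ (by omega) (by omega)) (hmem _ (by omega) (by omega))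
        (hP.adj a (by omega)) (hP.norm _ (by omega)) (hP.norm _ hb) c d (.inr hyb) ?_ hQx).symm
      obtain ⟨j, ⟨hj1, hj2⟩, hj3⟩ := hj
      obtain rfl | rfl : j = a ∨ j = a + 1 := by omega
      · exact .inl hj3
      · exact .inr hj3
    · obtain ⟨c, w, hw, hxw⟩ := exists_of_mem_span_Icc (by omega) hx
      obtain ⟨d, z, hz, rfl⟩ := exists_of_mem_span_Icc (by omega) hw
      obtain ⟨e, u, hu, rfl⟩ := exists_of_mem_span_Icc (by omega) hz
      obtain rfl : b = a + 2 := by omega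
      rw [hempty u hu, add_zero, sub_eq_iff_eq_add', ← add_assoc, ← add_assoc] at hxw
      subst hxw
      refine (hT.reach_triple hQ hα (hmem _ (by omega) (by omega)) (hmem _ (by omega) (by omega))
        (hmem _ (by omega) (by omega)) (hP.adj a (by omega)) (hP.adj (a + 1) hb)
        (hP.far _ _ (by omega) hb) (hP.norm _ (by omega)) (hP.norm _ hb) c d e ?_ hQx
        (hpres a)).symm
      rwa [hP.dual_zero _ _ (by omega) hb, zero_add]
    have fin : ∀ x', Reach (pathGroup T v (Set.Icc a b)) x x' →
        x' - y b ∈ span F (v '' Set.Icc (a + 1) b) →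
        (∃ j ∈ Set.Icc (a + 1) b, B x' (v j) ≠ 0) →
        Reach (pathGroup T v (Set.Icc a b)) x (y b) := by
      intro x' h h' h''
      exact h.trans ((ih (a + 1) (by omega) x' h' (hinv a x x' h hx hQx).2 h'').mono
        (pathGroup_mono T v (Set.Icc_subset_Icc_left (by omega))))
    obtain ⟨j, ⟨hj1, hj2⟩, hj3⟩ := hj
    obtain ⟨x₁, hx₁, hξ₁⟩ := hT.exists_reach_pairing_ne hP hb hj1 hj2
      (show a ≤ a + 3 by omega) (by omega) hj3
    obtain ⟨x₂, hx₂, hξ₂⟩ : ∃ x₂, Reach (pathGroup T v (Set.Icc a b)) x x₂ ∧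
        B x₂ (v a) + B x₂ (v (a + 2)) ≠ 0 := by
      by_cases h : B x₁ (v a) + B x₁ (v (a + 2)) = 0
      · refine ⟨_, hx₁.trans (hT.reach_step (hmem (a + 3) (by omega) (by omega)) x₁), ?_⟩
        simp only [map_add, LinearMap.add_apply, map_smul, LinearMap.smul_apply, smul_eq_mul,
          hT.form_comm (v (a + 3)), hP.adj (a + 2) (by omega), hP.far a (a + 3) (by omega)
          (by omega)]
        have : B x₁ (v a) + B x₁ (v (a + 3)) * 0 + (B x₁ (v (a + 2)) + B x₁ (v (a + 3)) * α) =
          B x₁ (v (a + 3)) * α := by linear_combination h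
        rw [this]
        exact mul_ne_zero hξ₁ hα0
      · exact ⟨x₁, hx₁, h⟩
    have h₀₁ := hP.adj a (by omega)
    have h₁₂ := hP.adj (a + 1) (by omega)
    have h₂₃ := hP.adj (a + 2) (by omega)
    have h₀₂ := hP.far a (a + 2) (by omega) (by omega)
    have h₁₃ := hP.far (a + 1) (a + 3) (by omega) (by omega)
    have h₀₃ := hP.far a (a + 3) (by omega) (by omega)
    obtain ⟨c, w, hw, hxw⟩ := exists_of_mem_span_Icc (by omega) (hinv a x x₂ hx₂ hx hQx).1
    obtain ⟨r, s, hx₃, hξ₃⟩ := hT.exists_reach_kill hQ hα (hmem a (by omega) (by omega))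
      (hmem (a + 1) (by omega) (by omega)) (hmem (a + 2) (by omega) (by omega)) h₀₁ h₁₂ h₀₂
      (hP.norm _ (by omega)) (hP.norm _ (by omega)) (hP.norm _ (by omega)) c hξ₂ (hpres a)
    have hβ : B (x₂ + c • v a + r • v (a + 1) + s • v (a + 2)) (v a) +
        B (x₂ + c • v a + r • v (a + 1) + s • v (a + 2)) (v (a + 2)) ≠ 0 := by
      simp only [map_add, LinearMap.add_apply, map_smul, LinearMap.smul_apply, smul_eq_mul,
        hT.self, hT.form_comm (v (a + 2)) (v a), hT.form_comm (v (a + 1)) (v a), h₀₁, h₁₂, h₀₂]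
      intro h
      exact hξ₂ (by linear_combination h - r * α * h2)
    have hmem₃ : x₂ + c • v a + r • v (a + 1) + s • v (a + 2) - y b ∈
        span F (v '' Set.Icc (a + 1) b) := by
      have : x₂ + c • v a + r • v (a + 1) + s • v (a + 2) - y b =
          w + r • v (a + 1) + s • v (a + 2) + ((2 : F) * c) • v a := by
        rw [sub_eq_iff_eq_add] at hxw
        rw [hxw]; module
      rw [this, h2, zero_mul, zero_smul, add_zero]
      exact add_mem (add_mem hw (smul_mem _ _ (mem_span_image ⟨by omega, by omega⟩)))
        (smul_mem _ _ (mem_span_image ⟨by omega, by omega⟩))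
    replace hx₃ := hx₂.trans hx₃
    generalize x₂ + c • v a + r • v (a + 1) + s • v (a + 2) = x₃ at *
    by_cases hbad : ∃ j ∈ Set.Icc (a + 1) b, B x₃ (v j) ≠ 0
    · exact fin x₃ hx₃ hmem₃ hbad
    push Not at hbad
    have z₂ := hbad (a + 2) ⟨by omega, by omega⟩
    have z₃ := hbad (a + 3) ⟨by omega, by omega⟩
    rw [z₂, add_zero] at hβ
    rcases Nat.eq_zero_or_pos n with rfl | hn
    · exfalso
      obtain ⟨d, z, hz, h⟩ := exists_of_mem_span_Icc (by omega) hmem₃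
      obtain ⟨e, w, hw, rfl⟩ := exists_of_mem_span_Icc (by omega) hz
      obtain ⟨f, u, hu, rfl⟩ := exists_of_mem_span_Icc (by omega) hw
      obtain rfl : b = a + 3 := by omega
      rw [hempty u hu, add_zero, sub_eq_iff_eq_add'] at h
      subst h
      simp only [map_add, LinearMap.add_apply, map_smul, LinearMap.smul_apply, smul_eq_mul, hT.self,
        hT.form_comm (v (a + 2)) (v (a + 1)), hT.form_comm (v (a + 3)) (v (a + 1)), h₁₂, h₂₃, h₁₃,
        hP.dual_zero (a + 1) (a + 3) (by omega) hb, add_assoc, Nat.reduceAdd] at hξ₃ z₃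
      exact hyb (by linear_combination z₃ - hξ₃)
    · obtain ⟨r, s, hx₄, hξ₄⟩ := hT.exists_reach_last hQ hα hP.exists_ne
        (hmem a (by omega) (by omega)) (hmem (a + 1) (by omega) (by omega))
        (hmem (a + 2) (by omega) (by omega)) (hmem (a + 3) (by omega) (by omega))
        (e₄ := v (a + 4)) h₀₁ h₁₂ h₂₃ (hP.adj (a + 3) (by omega)) h₀₂ h₀₃ h₁₃
        (hP.far (a + 1) (a + 4) (by omega) (by omega)) (hP.norm _ (by omega))
        (hP.norm _ (by omega)) (hP.norm _ (by omega)) (hP.norm _ (by omega)) hβ hξ₃ z₂ z₃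
        (hbad (a + 4) ⟨by omega, by omega⟩) (hpres a)
      refine fin _ (hx₃.trans hx₄) ?_ ⟨a + 4, ⟨by omega, by omega⟩, hξ₄⟩
      rw [add_assoc, add_sub_right_comm]
      exact add_mem hmem₃ (add_mem (smul_mem _ _ (mem_span_image ⟨by omega, by omega⟩))
        (smul_mem _ _ (mem_span_image ⟨by omega, by omega⟩)))

end IsTransvectionGroup
end Paths

section StringGroups

variable {G : Type*} [Group G]

theorem commute_of_mem_closure {s t : Set G} (h : ∀ x ∈ s, ∀ y ∈ t, Commute x y) {x y : G}
    (hx : x ∈ Subgroup.closure s) (hy : y ∈ Subgroup.closure t) : Commute x y := by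
  have ht : Subgroup.closure t ≤ Subgroup.centralizer s :=
    (Subgroup.closure_le _).2 fun y hy => Subgroup.mem_centralizer_iff.2 fun x hx => h x hx y hy
  have hs : Subgroup.closure s ≤ Subgroup.centralizer (Subgroup.closure t : Set G) :=
    (Subgroup.closure_le _).2 fun x hx => Subgroup.mem_centralizer_iff.2 fun y hy =>
      (Subgroup.mem_centralizer_iff.1 (ht hy) x hx).symm
  exact (Subgroup.mem_centralizer_iff.1 (hs hx) y hy).symm

theorem exists_last_run {I : Set ℕ} {k : ℕ} (hk : k ∈ I) :
    ∃ a ≤ k, Set.Ico a (k + 1) ⊆ I ∧ ∀ i ∈ I, i < a → i + 1 < a := by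
  classical
  have h : ∃ a, Set.Ico a (k + 1) ⊆ I :=
    ⟨k, fun i hi => by obtain rfl : i = k := by have := hi.1; have := hi.2; omega
                       exact hk⟩
  refine ⟨Nat.find h, Nat.find_min' h ?_, Nat.find_spec h, fun i hi hia => ?_⟩
  · intro i hi
    obtain rfl : i = k := by have := hi.1; have := hi.2; omega
    exact hk
  · by_contra hlt
    refine Nat.find_min h hia fun j hj => ?_
    rcases eq_or_lt_of_le hj.1 with rfl | hj'
    · exact hi
    · exact Nat.find_spec h ⟨by omega, hj.2⟩

/-- The subgroup generated by the elements `ρ i`, for `i ∈ I`. -/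
def generatedBy (ρ : ℕ → G) (I : Set ℕ) : Subgroup G := Subgroup.closure (ρ '' I)

theorem generatedBy_mono (ρ : ℕ → G) {I J : Set ℕ} (h : I ⊆ J) :
    generatedBy ρ I ≤ generatedBy ρ J :=
  Subgroup.closure_mono (Set.image_mono h)

variable {ρ : ℕ → G} {N : ℕ}

theorem exists_mul_of_mem_generatedBy (hc : ∀ i j, i + 1 < j → j < N → Commute (ρ i) (ρ j))
    {I : Set ℕ} {k a : ℕ} (hk : k < N) (hI : I ⊆ Set.Iio (k + 1))
    (ha : ∀ i ∈ I, i < a → i + 1 < a) {g : G} (hg : g ∈ generatedBy ρ I) :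
    ∃ g₁ ∈ generatedBy ρ {i ∈ I | i + 1 < a}, ∃ g₂ ∈ generatedBy ρ (Set.Ico a (k + 1)),
      g = g₁ * g₂ := by
  have hcomm : ∀ g₁ ∈ generatedBy ρ {i ∈ I | i + 1 < a},
      ∀ g₂ ∈ generatedBy ρ (Set.Ico a (k + 1)), Commute g₁ g₂ := by
    intro g₁ h₁ g₂ h₂
    refine commute_of_mem_closure ?_ h₁ h₂
    rintro _ ⟨i, ⟨-, hi⟩, rfl⟩ _ ⟨j, ⟨hj, hj'⟩, rfl⟩
    exact hc i j (by omega) (by omega)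
  induction hg using Subgroup.closure_induction with
  | mem g hg =>
    obtain ⟨i, hi, rfl⟩ := hg
    by_cases hia : i < a
    · exact ⟨_, Subgroup.subset_closure ⟨i, ⟨hi, ha i hi hia⟩, rfl⟩, 1, one_mem _,
        (mul_one _).symm⟩
    · exact ⟨1, one_mem _, _, Subgroup.subset_closure ⟨i, ⟨by omega, hI hi⟩, rfl⟩,
        (one_mul _).symm⟩
  | one => exact ⟨1, one_mem _, 1, one_mem _, (one_mul _).symm⟩
  | mul g h _ _ hg hh =>
    obtain ⟨g₁, hg₁, g₂, hg₂, rfl⟩ := hg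
    obtain ⟨h₁, hh₁, h₂, hh₂, rfl⟩ := hh
    exact ⟨g₁ * h₁, mul_mem hg₁ hh₁, g₂ * h₂, mul_mem hg₂ hh₂,
      ((hcomm h₁ hh₁ g₂ hg₂).symm.mul_mul_mul_comm g₁ h₂)⟩
  | inv g _ hg =>
    obtain ⟨g₁, hg₁, g₂, hg₂, rfl⟩ := hg
    exact ⟨g₁⁻¹, inv_mem hg₁, g₂⁻¹, inv_mem hg₂, by
      rw [(hcomm g₁ hg₁ g₂ hg₂).eq, mul_inv_rev]⟩

/-- For commuting strings of generators, the intersection property follows from the intersection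
property for an interval and an initial segment missing its last element. -/
theorem generatedBy_inter (hc : ∀ i j, i + 1 < j → j < N → Commute (ρ i) (ρ j))
    (hinter : ∀ a k, k < N → ∀ g ∈ generatedBy ρ (Set.Ico a (k + 1)),
      g ∈ generatedBy ρ (Set.Ico 0 k) → g ∈ generatedBy ρ (Set.Ico a k)) (k : ℕ) (hk : k ≤ N) :
    ∀ I J : Set ℕ, I ⊆ Set.Iio k → J ⊆ Set.Iio k → ∀ g ∈ generatedBy ρ I, g ∈ generatedBy ρ J →
      g ∈ generatedBy ρ (I ∩ J) := by
  induction k with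
  | zero =>
    intro I J hI hJ g hg hg'
    have : I ⊆ I ∩ J := fun i hi => absurd (hI hi) (by simp)
    exact generatedBy_mono ρ this hg
  | succ k ih =>
    have below : ∀ I : Set ℕ, I ⊆ Set.Iio (k + 1) → k ∉ I → I ⊆ Set.Iio k := by
      intro I hI hkI i hi
      have h1 : i < k + 1 := hI hi
      have h2 : i ≠ k := fun h => hkI (h ▸ hi)
      exact show i < k by omega
    have single : ∀ I J : Set ℕ, I ⊆ Set.Iio (k + 1) → J ⊆ Set.Iio (k + 1) → k ∉ J →
        ∀ g ∈ generatedBy ρ I, g ∈ generatedBy ρ J → g ∈ generatedBy ρ (I ∩ J) := by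
      intro I J hI hJ hkJ g hg hg'
      have hJ' := below J hJ hkJ
      by_cases hkI : k ∈ I
      · obtain ⟨a, hak, haI, ha⟩ := exists_last_run hkI
        obtain ⟨g₁, hg₁, g₂, hg₂, rfl⟩ := exists_mul_of_mem_generatedBy hc (by omega) hI ha hg
        have h₁ : g₁ ∈ generatedBy ρ (Set.Ico 0 k) := by
          refine generatedBy_mono ρ ?_ hg₁
          rintro i ⟨-, hi⟩
          exact ⟨by omega, by omega⟩
        have h₂ : g₂ ∈ generatedBy ρ (Set.Ico 0 k) := by
          have hJk : J ⊆ Set.Ico 0 k := fun i hi => ⟨Nat.zero_le i, hJ' hi⟩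
          have := mul_mem (inv_mem h₁) (generatedBy_mono ρ hJk hg')
          rwa [inv_mul_cancel_left] at this
        have h₃ := hinter a k (by omega) g₂ hg₂ h₂
        have hI' : g₁ * g₂ ∈ generatedBy ρ (I ∩ Set.Iio k) := by
          refine mul_mem (generatedBy_mono ρ ?_ hg₁) (generatedBy_mono ρ ?_ h₃)
          · rintro i ⟨hi, hi'⟩
            exact ⟨hi, show i < k by omega⟩
          · rintro i ⟨hi, hi'⟩
            exact ⟨haI ⟨hi, by omega⟩, hi'⟩
        refine generatedBy_mono ρ ?_
          (ih (by omega) _ J Set.inter_subset_right hJ' _ hI' hg')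
        rintro i ⟨⟨hi, -⟩, hj⟩
        exact ⟨hi, hj⟩
      · exact ih (by omega) I J (below I hI hkI) hJ' g hg hg'
    have double : ∀ I J : Set ℕ, I ⊆ Set.Iio (k + 1) → J ⊆ Set.Iio (k + 1) → ∀ a b, a ≤ b →
        b ≤ k → Set.Ico a (k + 1) ⊆ I → Set.Ico b (k + 1) ⊆ J →
        (∀ i ∈ J, i < b → i + 1 < b) → ∀ g ∈ generatedBy ρ I, g ∈ generatedBy ρ J →
        g ∈ generatedBy ρ (I ∩ J) := by
      intro I J hI hJ a b hab hbk haI hbJ hb g hg hg'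
      obtain ⟨h₁, hh₁, h₂, hh₂, rfl⟩ := exists_mul_of_mem_generatedBy hc (by omega) hJ hb hg'
      have hh₂' : h₂ ∈ generatedBy ρ (I ∩ J) := by
        refine generatedBy_mono ρ ?_ hh₂
        rintro i hi
        exact ⟨haI ⟨hab.trans hi.1, hi.2⟩, hbJ hi⟩
      have hh₁' : h₁ ∈ generatedBy ρ I := by
        have := mul_mem hg (inv_mem (generatedBy_mono ρ Set.inter_subset_left hh₂'))
        rwa [mul_inv_cancel_right] at this
      refine mul_mem (generatedBy_mono ρ ?_ (single I _ hI (fun i hi => hJ hi.1) ?_ h₁ hh₁' hh₁))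
        hh₂'
      · rintro i ⟨hi, hi', -⟩
        exact ⟨hi, hi'⟩
      · rintro ⟨-, h⟩
        omega
    intro I J hI hJ g hg hg'
    by_cases hkI : k ∈ I
    · by_cases hkJ : k ∈ J
      · obtain ⟨a, hak, haI, ha⟩ := exists_last_run hkI
        obtain ⟨b, hbk, hbJ, hb⟩ := exists_last_run hkJ
        rcases le_total a b with h | h
        · exact double I J hI hJ a b h hbk haI hbJ hb g hg hg'
        · rw [Set.inter_comm]
          exact double J I hJ hI b a h hak hbJ haI ha g hg' hg
      · exact single I J hI hJ hkJ g hg hg'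
    · rw [Set.inter_comm]
      exact single J I hJ hI hkI g hg' hg

end StringGroups

section PathStabilizers

variable {F V G : Type*} [Field F] [AddCommGroup V] [Module F V] [Group G] [DistribMulAction G V]
  {B : V →ₗ[F] V →ₗ[F] F} {T : V → G} {Q : V → F}

open Submodule

theorem IsPath.dual_span {α : F} {v y : ℕ → V} {N : ℕ} (hP : IsPath B Q α v y N) {a b : ℕ}
    (hb : b < N) {w : V} (hw : w ∈ span F (v '' Set.Ico a b)) : B (y b) w = 0 := by
  have : span F (v '' Set.Ico a b) ≤ LinearMap.ker (B (y b)) := by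
    rw [span_le]
    rintro _ ⟨j, hj, rfl⟩
    exact hP.dual_zero j b hj.2 hb
  exact this hw

namespace IsTransvectionGroup

/-- The group of a subpath consists of all elements preserving the quadratic form and acting
trivially modulo the span of the subpath. -/
theorem mem_pathGroup_of_preserves [Finite F] [CharP F 2] (hT : IsTransvectionGroup B T) {α : F}
    {v y : ℕ → V} {N : ℕ} (hP : IsPath B Q α v y N) (a e : ℕ) (he : e ≤ N) :
    ∀ g : G, (∀ x, Q (g • x) = Q x) → (∀ x, g • x - x ∈ span F (v '' Set.Ico a e)) →
      g ∈ pathGroup T v (Set.Ico a e) := by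
  have base : ∀ e ≤ a, ∀ g : G, (∀ x, g • x - x ∈ span F (v '' Set.Ico a e)) →
      g ∈ pathGroup T v (Set.Ico a e) := by
    intro e he g hg
    rw [hT.faithful g fun x => ?_]
    · exact one_mem _
    · simpa [Set.Ico_eq_empty_of_le he, sub_eq_zero] using hg x
  induction e with
  | zero => exact fun g _ hg => base 0 (Nat.zero_le _) g hg
  | succ b ih =>
    intro g hgQ hg
    rcases Nat.lt_or_ge b a with hba | hab
    · exact base (b + 1) hba g hg
    have hyb := hP.dual_ne b he
    have hset : Set.Ico a (b + 1) = Set.Icc a b := by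
      ext i; simp only [Set.mem_Ico, Set.mem_Icc]; omega
    obtain ⟨h, hh, hhy⟩ : Reach (pathGroup T v (Set.Icc a b)) (g • y b) (y b) := by
      refine hT.reach_dual hP he (b - a) a (by omega) _ (hset ▸ hg (y b)) (hgQ _) ?_
      by_contra! hfix
      have hle : span F (v '' Set.Icc a b) ≤ LinearMap.ker (B (g • y b)) := by
        rw [span_le]
        rintro _ ⟨j, hj, rfl⟩
        exact hfix j hj
      have hgb : g • v b ∈ span F (v '' Set.Icc a b) := by
        rw [← sub_add_cancel (g • v b) (v b)]
        exact add_mem (hset ▸ hg (v b)) (mem_span_image ⟨hab, le_rfl⟩)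
      exact hyb (by rw [← hT.invariant g]; exact hle hgb)
    rw [← hset] at hh
    have hhQ := hT.pathGroup_preserves hP.quadratic
      (fun i hi => hP.norm i (lt_of_lt_of_le hi.2 he)) hh
    have hmem : h * g ∈ pathGroup T v (Set.Ico a b) := by
      refine ih (by omega) (h * g) (fun x => by rw [mul_smul, hhQ, hgQ]) fun x => ?_
      have hx : (h * g) • x - x ∈ span F (v '' Set.Ico a (b + 1)) := by
        rw [mul_smul, ← sub_add_sub_cancel]
        exact add_mem (hT.pathGroup_sub_mem hh _) (hg x)
      obtain ⟨c, w, hw, hxw⟩ := exists_of_mem_span_Ico_succ hab hx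
      have h0 : B (y b) ((h * g) • x - x) = 0 := by
        rw [map_sub]
        nth_rewrite 1 [← hhy]
        rw [← mul_smul, hT.invariant, sub_self]
      rw [hxw, map_add, map_smul, hP.dual_span he hw, add_zero, smul_eq_mul] at h0
      rw [hxw, (mul_eq_zero.1 h0).resolve_right hyb, zero_smul, zero_add]
      exact hw
    have := mul_mem (inv_mem hh)
      (pathGroup_mono T v (Set.Ico_subset_Ico_right (Nat.le_succ b)) hmem)
    rwa [inv_mul_cancel_left] at this

theorem pathGroup_inter [Finite F] [CharP F 2] (hT : IsTransvectionGroup B T) {α : F}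
    {v y : ℕ → V} {N : ℕ} (hP : IsPath B Q α v y N) {a k : ℕ} (hk : k < N) {g : G}
    (hg : g ∈ pathGroup T v (Set.Ico a (k + 1))) (hg' : g ∈ pathGroup T v (Set.Ico 0 k)) :
    g ∈ pathGroup T v (Set.Ico a k) := by
  refine hT.mem_pathGroup_of_preserves hP a k hk.le g (hT.pathGroup_preserves hP.quadratic
    (fun i hi => hP.norm i (hi.2.trans hk)) hg') fun x => ?_
  have hx := hT.pathGroup_sub_mem hg x
  rcases Nat.lt_or_ge k a with hka | hak
  · rw [Set.Ico_eq_empty_of_le hka] at hx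
    rw [Set.Ico_eq_empty_of_le hka.le]
    exact hx
  obtain ⟨c, w, hw, hxw⟩ := exists_of_mem_span_Ico_succ hak hx
  have h0 := hP.dual_span hk (hT.pathGroup_sub_mem hg' x)
  rw [hxw, map_add, map_smul, hP.dual_span hk hw, add_zero, smul_eq_mul] at h0
  rw [hxw, (mul_eq_zero.1 h0).resolve_right (hP.dual_ne k hk), zero_smul, zero_add]
  exact hw

theorem exists_of_mem_pathGroup_last [CharP F 2] (hT : IsTransvectionGroup B T) {α : F}
    {v y : ℕ → V} {N : ℕ} (hP : IsPath B Q α v y N) {a : ℕ} {g : G}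
    (hg : g ∈ pathGroup T v (Set.Ico a (N + 1))) :
    ∀ x, ∃ c : F, g • x - x + c • v N ∈ span F (v '' Set.Ico a N) ∧
      Q (g • x) + Q x = c ^ 2 * (1 + Q (v N)) := by
  have h2 : (2 : F) = 0 := CharTwo.two_eq_zero
  have hQ := hP.quadratic
  induction hg using Subgroup.closure_induction with
  | mem g hg =>
    obtain ⟨i, ⟨hai, hi⟩, rfl⟩ := hg
    intro x
    simp only
    rcases Nat.lt_or_ge i N with hiN | hiN
    · refine ⟨0, ?_, ?_⟩
      · rw [hT.smul_eq, add_sub_cancel_left, zero_smul, add_zero]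
        exact smul_mem _ _ (mem_span_image ⟨hai, hiN⟩)
      · rw [hT.map_smul_eq hQ (hP.norm i hiN)]
        linear_combination Q x * h2
    · obtain rfl : i = N := by omega
      refine ⟨B x (v i), ?_, ?_⟩
      · have : T (v i) • x - x + B x (v i) • v i = ((2 : F) * B x (v i)) • v i := by
          rw [hT.smul_eq]; module
        rw [this, h2, zero_mul, zero_smul]
        exact zero_mem _
      · rw [hT.smul_eq, hQ.map_add, hQ.map_smul, map_smul, smul_eq_mul]
        linear_combination Q x * h2
  | one =>
    refine fun x => ⟨0, by simp, ?_⟩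
    rw [one_smul]
    linear_combination Q x * h2
  | mul g h _ _ hg hh =>
    intro x
    obtain ⟨c, hc, hcQ⟩ := hg (h • x)
    obtain ⟨d, hd, hdQ⟩ := hh x
    refine ⟨c + d, ?_, ?_⟩
    · have : (g * h) • x - x + (c + d) • v N =
          (g • h • x - h • x + c • v N) + (h • x - x + d • v N) := by
        rw [mul_smul]
        generalize h • x = u
        generalize g • u = z
        module
      rw [this]
      exact add_mem hc hd
    · rw [mul_smul]
      linear_combination hcQ + hdQ - (Q (h • x) + c * d * (1 + Q (v N))) * h2
  | inv g _ hg =>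
    intro x
    obtain ⟨c, hc, hcQ⟩ := hg (g⁻¹ • x)
    rw [smul_inv_smul] at hc hcQ
    refine ⟨c, ?_, by rw [← hcQ, add_comm]⟩
    generalize g⁻¹ • x = z at hc ⊢
    have : z - x + c • v N = -(x - z + c • v N) + ((2 : F) * c) • v N := by module
    rw [this, h2, zero_mul, zero_smul, add_zero]
    exact neg_mem hc

theorem pathGroup_inter_last [Finite F] [CharP F 2] (hT : IsTransvectionGroup B T) {α : F}
    {v y : ℕ → V} {N : ℕ} (hP : IsPath B Q α v y N) (hQN : Q (v N) ≠ 1) {a : ℕ} {g : G}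
    (hg : g ∈ pathGroup T v (Set.Ico a (N + 1))) (hg' : g ∈ pathGroup T v (Set.Ico 0 N)) :
    g ∈ pathGroup T v (Set.Ico a N) := by
  have h2 : (2 : F) = 0 := CharTwo.two_eq_zero
  have hgQ := hT.pathGroup_preserves hP.quadratic (fun i hi => hP.norm i hi.2) hg'
  refine hT.mem_pathGroup_of_preserves hP a N le_rfl g hgQ fun x => ?_
  obtain ⟨c, hc, hcQ⟩ := hT.exists_of_mem_pathGroup_last hP hg x
  have h0 : c ^ 2 * (1 + Q (v N)) = 0 := by
    rw [← hcQ, hgQ]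
    linear_combination Q x * h2
  have hne : 1 + Q (v N) ≠ 0 := fun h => hQN (by linear_combination h - h2)
  have hc0 : c = 0 := pow_eq_zero_iff two_ne_zero |>.1 ((mul_eq_zero.1 h0).resolve_right hne)
  simpa [hc0] using hc

end IsTransvectionGroup
end PathStabilizers

section Generation

variable {F V G : Type*} [Field F] [AddCommGroup V] [Module F V] [Group G] [DistribMulAction G V]
  {B : V →ₗ[F] V →ₗ[F] F} {T : V → G} {Q : V → F}

namespace IsTransvectionGroup

/-- The subspace of vectors fixed by `g`. -/
def fixedSpace (hT : IsTransvectionGroup B T) (g : G) : Submodule F V where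
  carrier := {x | g • x = x}
  zero_mem' := smul_zero g
  add_mem' {x y} hx hy := by
    rw [Set.mem_ofPred_eq] at *
    rw [smul_add, hx, hy]
  smul_mem' c x hx := by
    rw [Set.mem_ofPred_eq] at *
    rw [hT.smul_comm_scalar, hx]

theorem mem_fixedSpace (hT : IsTransvectionGroup B T) {g : G} {x : V} :
    x ∈ hT.fixedSpace g ↔ g • x = x := Iff.rfl

theorem exists_fixedSpace_lt [Finite F] [CharP F 2] (hT : IsTransvectionGroup B T) {g : G} {x : V}
    (hx : B x (g • x) ≠ 0) : ∃ w, hT.fixedSpace g < hT.fixedSpace (T w * g) := by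
  have h2 : (2 : F) = 0 := CharTwo.two_eq_zero
  obtain ⟨c, hc⟩ := exists_sq_eq (B x (g • x))⁻¹
  refine ⟨c • (g • x + x), SetLike.lt_iff_le_and_exists.2 ⟨fun y hy => ?_, x, ?_, ?_⟩⟩
  · rw [mem_fixedSpace] at *
    have : B y (g • x) = B y x := by
      nth_rewrite 1 [← hy]
      exact hT.invariant g y x
    rw [mul_smul, hy, hT.smul_eq, map_smul, map_add, this, CharTwo.add_self_eq_zero, smul_zero,
      zero_smul, add_zero]
  · have hc' : c ^ 2 * B (g • x) x = 1 := by
      rw [hc, hT.form_comm (g • x) x, inv_mul_cancel₀ hx]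
    rw [mem_fixedSpace, mul_smul, hT.smul_eq, map_smul, map_add, hT.self, zero_add, smul_eq_mul]
    generalize g • x = z at *
    have : z + (c * B z x) • c • (z + x) = z + (c ^ 2 * B z x) • (z + x) := by module
    rw [this, hc']
    have : z + (1 : F) • (z + x) = x + (2 : F) • z := by module
    rw [this, h2, zero_smul, add_zero]
  · intro h
    rw [mem_fixedSpace] at h
    exact hx (by rw [h, hT.self])

theorem exists_fixedSpace_lt_of_ne_one [Finite F] [CharP F 2] (hT : IsTransvectionGroup B T)
    {H : Subgroup G} (hH : ∀ v, T v ∈ H) {g : G} (hg : g ≠ 1) :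
    ∃ h ∈ H, hT.fixedSpace g < hT.fixedSpace (h * g) := by
  have h2 : (2 : F) = 0 := CharTwo.two_eq_zero
  by_cases hex : ∃ x, B x (g • x) ≠ 0
  · obtain ⟨x, hx⟩ := hex
    obtain ⟨w, hw⟩ := hT.exists_fixedSpace_lt hx
    exact ⟨T w, hH w, hw⟩
  push Not at hex
  obtain ⟨y, hy⟩ : ∃ y : V, g • y ≠ y := by
    by_contra! h
    exact hg (hT.faithful g h)
  have hsymm : ∀ x, B x (g • y) = B (g • x) y := by
    intro x
    have h := hex (x + y)
    rw [smul_add, map_add, map_add, LinearMap.add_apply, LinearMap.add_apply, hex, hex,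
      hT.form_comm y] at h
    linear_combination h - B (g • x) y * h2
  obtain ⟨x, hx⟩ : ∃ x, B x (g • y - y) ≠ 0 := by
    by_contra! h
    exact hy (sub_eq_zero.1 (hT.nondeg _ fun x => by rw [hT.form_comm, h]))
  have hle : hT.fixedSpace g ≤ hT.fixedSpace (T (g • y - y) * g) := by
    intro z hz
    rw [mem_fixedSpace] at *
    have : B z (g • y - y) = 0 := by
      rw [map_sub, hsymm, hz, sub_self]
    rw [mul_smul, hz, hT.smul_eq, this, zero_smul, add_zero]
  have hne : B x ((T (g • y - y) * g) • x) ≠ 0 := by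
    have : B (g • x) (g • y - y) = B x (g • y - y) := by
      rw [map_sub, map_sub, hT.invariant, hsymm]
      linear_combination (B x y - B (g • x) y) * h2
    rw [mul_smul, hT.smul_eq, map_add, hex, zero_add, map_smul, smul_eq_mul, this]
    exact mul_ne_zero hx hx
  obtain ⟨w, hw⟩ := hT.exists_fixedSpace_lt hne
  exact ⟨T w * T (g • y - y), mul_mem (hH _) (hH _), by rw [mul_assoc]; exact hle.trans_lt hw⟩

/-- The transvections generate the whole group. -/
theorem eq_top_of_forall_mem [Finite F] [CharP F 2] [FiniteDimensional F V]
    (hT : IsTransvectionGroup B T) {H : Subgroup G} (hH : ∀ v, T v ∈ H) : H = ⊤ := by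
  refine (Subgroup.eq_top_iff' H).2 fun g => ?_
  induction hW : hT.fixedSpace g using WellFoundedGT.induction generalizing g with
  | ind W ih =>
    by_cases hg : g = 1
    · exact hg ▸ one_mem H
    · obtain ⟨h, hh, hlt⟩ := hT.exists_fixedSpace_lt_of_ne_one hH hg
      have := mul_mem (inv_mem hh) (ih _ (hW ▸ hlt) (h * g) rfl)
      rwa [inv_mul_cancel_left] at this

theorem mem_of_reach (hT : IsTransvectionGroup B T) {H : Subgroup G} {u v : V} (hu : T u ∈ H)
    (h : Reach H u v) : T v ∈ H := by
  obtain ⟨g, hg, rfl⟩ := h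
  rw [← hT.conj_eq]
  exact mul_mem (mul_mem hg hu) (inv_mem hg)

theorem reach_of_form_ne_zero [Finite F] [CharP F 2] (hT : IsTransvectionGroup B T)
    (hQ : IsQuadraticForm B Q) {H : Subgroup G} (hH : ∀ z, Q z = 1 → T z ∈ H) {a b : V}
    (hab : B a b ≠ 0) (hQab : Q a = Q b) : Reach H a b := by
  have h2 : (2 : F) = 0 := CharTwo.two_eq_zero
  obtain ⟨c, hc⟩ := exists_sq_eq (B a b)⁻¹
  have hc' : c ^ 2 * B a b = 1 := by rw [hc, inv_mul_cancel₀ hab]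
  refine ⟨T (c • (a + b)), hH _ ?_, ?_⟩
  · rw [hQ.map_smul, hQ.map_add, hQab]
    linear_combination hc' + c ^ 2 * Q b * h2
  · rw [hT.smul_eq, map_smul, map_add, hT.self, zero_add, smul_eq_mul]
    have : a + (c * B a b) • c • (a + b) = a + (c ^ 2 * B a b) • (a + b) := by module
    rw [this, hc']
    have : a + (1 : F) • (a + b) = b + (2 : F) • a := by module
    rw [this, h2, zero_smul, add_zero]

theorem exists_form_eq_one (hT : IsTransvectionGroup B T) {a : V} (ha : a ≠ 0) :
    ∃ c, B a c = 1 := by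
  obtain ⟨z, hz⟩ : ∃ z, B a z ≠ 0 := by
    by_contra! h
    exact ha (hT.nondeg a h)
  exact ⟨(B a z)⁻¹ • z, by rw [map_smul, smul_eq_mul, inv_mul_cancel₀ hz]⟩

/-- Witt's extension theorem for a single vector. -/
theorem reach_of_norm_eq [Finite F] [CharP F 2] (hT : IsTransvectionGroup B T)
    (hQ : IsQuadraticForm B Q) (ht : ∃ t : F, t ≠ 0 ∧ t ≠ 1) {H : Subgroup G}
    (hH : ∀ z, Q z = 1 → T z ∈ H) {a b : V} (ha : a ≠ 0) (hb : b ≠ 0) (hQab : Q a = Q b) :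
    Reach H a b := by
  have h2 : (2 : F) = 0 := CharTwo.two_eq_zero
  by_cases hab : B a b = 0
  swap
  · exact hT.reach_of_form_ne_zero hQ hH hab hQab
  by_cases hne : a = b
  · exact hne ▸ Reach.refl H a
  obtain ⟨c, t, hac, hbc, ht0, ht1⟩ : ∃ c t, B a c = 1 ∧ B b c = t ∧ t ≠ 0 ∧ t ≠ 1 := by
    obtain ⟨c, hc⟩ := hT.exists_form_eq_one ha
    by_cases h : ∀ x, B a x = 0 → B b x = 0
    · have hlin : b = B b c • a := by
        refine sub_eq_zero.1 (hT.nondeg _ fun x => ?_)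
        have := h (x - B a x • c) (by rw [map_sub, map_smul, hc, smul_eq_mul, mul_one, sub_self])
        rw [map_sub, map_smul, smul_eq_mul] at this
        rw [map_sub, map_smul, LinearMap.sub_apply, LinearMap.smul_apply, smul_eq_mul]
        linear_combination this
      refine ⟨c, B b c, hc, rfl, fun h0 => hb ?_, fun h1 => hne ?_⟩
      · rw [hlin, h0, zero_smul]
      · rw [h1, one_smul] at hlin
        exact hlin.symm
    · push Not at h
      obtain ⟨d, had, hbd⟩ := h
      obtain ⟨t, ht0, ht1⟩ := ht
      refine ⟨c + ((t - B b c) / B b d) • d, t, ?_, ?_, ht0, ht1⟩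
      · rw [map_add, map_smul, hc, had, smul_zero, add_zero]
      · rw [map_add, map_smul, smul_eq_mul, div_mul_cancel₀ _ hbd, add_sub_cancel]
  have ht1' : 1 + t ≠ 0 := fun h => ht1 (by linear_combination h - h2)
  obtain ⟨μ, hμ⟩ : ∃ μ : F, μ * (1 + t) = Q c + Q a :=
    ⟨(Q c + Q a) / (1 + t), div_mul_cancel₀ _ ht1'⟩
  have hca : B c a = 1 := by rw [hT.form_comm, hac]
  have hcb : B c b = t := by rw [hT.form_comm, hbc]
  have hba : B b a = 0 := by rw [hT.form_comm, hab]
  have hQc : Q (c + μ • a + μ • b) = Q a := by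
    simp only [hQ.map_add, hQ.map_smul, map_add, LinearMap.add_apply, map_smul,
      LinearMap.smul_apply, smul_eq_mul, hca, hcb, hab, ← hQab]
    linear_combination hμ + (Q c + μ ^ 2 * Q a) * h2
  refine Reach.trans (y := c + μ • a + μ • b) (hT.reach_of_form_ne_zero hQ hH ?_ hQc.symm)
    (hT.reach_of_form_ne_zero hQ hH ?_ (hQc.trans hQab))
  · simp [hac, hT.self, hab]
  · simp [hcb, hT.self, hab, ht0]

theorem exists_orthogonal_norm_ne_zero [CharP F 2] [FiniteDimensional F V]
    (hT : IsTransvectionGroup B T) (hQ : IsQuadraticForm B Q)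
    (hdim : 2 < Module.finrank F V) {u w : V} (huw : B u w ≠ 0) :
    ∃ n, B u n = 0 ∧ B w n = 0 ∧ Q n ≠ 0 := by
  have h2 : (2 : F) = 0 := CharTwo.two_eq_zero
  have hker := LinearMap.ker_ne_bot_of_finrank_lt (f := (B u).prod (B w)) (by simpa using hdim)
  obtain ⟨n, hn, hn0⟩ := (Submodule.ne_bot_iff _).1 hker
  rw [LinearMap.mem_ker] at hn
  have hun : B u n = 0 := congrArg Prod.fst hn
  have hwn : B w n = 0 := congrArg Prod.snd hn
  by_cases hQn : Q n = 0
  swap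
  · exact ⟨n, hun, hwn, hQn⟩
  obtain ⟨z, hz⟩ := hT.exists_form_eq_one hn0
  have hnu : B n u = 0 := by rw [hT.form_comm, hun]
  have hnw : B n w = 0 := by rw [hT.form_comm, hwn]
  obtain ⟨z', hz', huz, hwz⟩ : ∃ z', B n z' = 1 ∧ B u z' = 0 ∧ B w z' = 0 := by
    refine ⟨z + (B w z / B u w) • u + (B u z / B u w) • w, ?_, ?_, ?_⟩
    · simp [hz, hnu, hnw]
    · rw [map_add, map_add, map_smul, map_smul, hT.self, smul_zero, add_zero, smul_eq_mul,
        div_mul_cancel₀ _ huw, CharTwo.add_self_eq_zero]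
    · rw [map_add, map_add, map_smul, map_smul, hT.self, smul_zero, add_zero, smul_eq_mul,
        hT.form_comm w u, div_mul_cancel₀ _ huw, CharTwo.add_self_eq_zero]
  by_cases hQz : Q z' = 0
  · refine ⟨n + z', ?_, ?_, ?_⟩
    · rw [map_add, hun, huz, add_zero]
    · rw [map_add, hwn, hwz, add_zero]
    · rw [hQ.map_add, hQn, hQz, hz', zero_add, zero_add]
      exact one_ne_zero
  · exact ⟨z', huz, hwz, hQz⟩

theorem forall_mem_of_two_lt_finrank [Finite F] [CharP F 2] [FiniteDimensional F V]
    (hT : IsTransvectionGroup B T) (hQ : IsQuadraticForm B Q) (ht : ∃ t : F, t ≠ 0 ∧ t ≠ 1)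
    (hdim : 2 < Module.finrank F V) {H : Subgroup G} (hH : ∀ z, Q z = 1 → T z ∈ H) {u : V}
    (hu0 : u ≠ 0) (hQu : Q u ≠ 1) (huH : T u ∈ H) (v : V) : T v ∈ H := by
  have h2 : (2 : F) = 0 := CharTwo.two_eq_zero
  have hne : ∀ x : F, x ≠ 1 → 1 + x ≠ 0 := fun x hx h => hx (by linear_combination h - h2)
  by_cases hv0 : v = 0
  · have : T v = 1 := hT.faithful _ fun x => by rw [hT.smul_eq, hv0, smul_zero, add_zero]
    exact this ▸ one_mem H
  by_cases hQv : Q v = 1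
  · exact hH v hQv
  obtain ⟨η, hη⟩ := exists_sq_eq ((1 + Q v) / (1 + Q u))
  have hη' : η ^ 2 * (1 + Q u) = 1 + Q v := by rw [hη, div_mul_cancel₀ _ (hne _ hQu)]
  have hη0 : η ≠ 0 := by
    rintro rfl
    exact hne _ hQv (by rw [← hη', sq, zero_mul, zero_mul])
  obtain ⟨z, hz⟩ := hT.exists_form_eq_one hv0
  have hvz : B v (η • z) = η := by rw [map_smul, hz, smul_eq_mul, mul_one]
  obtain ⟨n, hvn, hzn, hQn⟩ := hT.exists_orthogonal_norm_ne_zero hQ hdim (u := v) (w := η • z)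
    (by rw [hvz]; exact hη0)
  obtain ⟨μ, hμ⟩ := exists_sq_eq ((Q u + Q (η • z)) / Q n)
  have hvb : B v (η • z + μ • n) = η := by rw [map_add, hvz, map_smul, hvn, smul_zero, add_zero]
  have hQb : Q (η • z + μ • n) = Q u := by
    rw [hQ.map_add, hQ.map_smul μ, hμ, div_mul_cancel₀ _ hQn, map_smul, hzn, smul_zero]
    linear_combination Q (η • z) * h2
  have hb0 : η • z + μ • n ≠ 0 := by
    intro h
    rw [h, map_zero] at hvb
    exact hη0 hvb.symm
  have hb := hT.mem_of_reach huH (hT.reach_of_norm_eq hQ ht hH hu0 hb0 hQb.symm)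
  generalize η • z + μ • n = b at *
  have : Q (T b • v) = 1 := by
    rw [hT.smul_eq, hQ.map_add, hQ.map_smul, map_smul, hvb, hQb, smul_eq_mul]
    linear_combination hη' + Q v * h2
  exact hT.mem_of_reach (hH _ this) (Reach.symm ⟨T b, hb, rfl⟩)

theorem forall_mem_of_plane [CharP F 2] (hT : IsTransvectionGroup B T) {α t : F}
    (hα : IsGoodParameter α) (ht0 : t ≠ 0) (ht1 : t ≠ 1) {H : Subgroup G} {e₀ e₁ : V}
    (h₀ : T e₀ ∈ H) (h₁ : T e₁ ∈ H) (h₂ : T (t • e₀) ∈ H) (h₀₁ : B e₀ e₁ = α)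
    (hinj : ∀ x, B x e₀ = 0 → B x e₁ = 0 → x = 0) (v : V) : T v ∈ H := by
  have h2 : (2 : F) = 0 := CharTwo.two_eq_zero
  have h₁₀ : B e₁ e₀ = α := by rw [hT.form_comm, h₀₁]
  by_cases hv0 : v = 0
  · have : T v = 1 := hT.faithful _ fun x => by rw [hT.smul_eq, hv0, smul_zero, add_zero]
    exact this ▸ one_mem H
  have hδ : t ^ 2 * α ≠ α := by
    intro h
    have h' : (t - 1) ^ 2 * α = 0 := by linear_combination h + (α - t * α) * h2
    rcases mul_eq_zero.1 h' with h' | h'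
    · exact ht1 (sub_eq_zero.1 (pow_eq_zero_iff two_ne_zero |>.1 h'))
    · exact hα.ne_zero h'
  obtain ⟨z, hz, hzv⟩ := exists_of_reflTransGen (S := fun z => Reach H e₀ z)
    (c := fun z => (B z e₀, B z e₁)) (r := PlaneMove α (t ^ 2 * α) 0) (x := e₀)
    (q := (B v e₀, B v e₁)) (by
      rintro z q hz (rfl | rfl | rfl)
      · refine ⟨_, hz.trans (hT.reach_step h₀ _), ?_⟩
        simp [hT.self, h₀₁, mul_comm]
      · refine ⟨_, hz.trans (hT.reach_step h₁ _), ?_⟩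
        simp [hT.self, h₁₀, mul_comm]
      · refine ⟨_, hz.trans (hT.reach_step h₂ _), ?_⟩
        simp only [map_add, LinearMap.add_apply, map_smul, LinearMap.smul_apply, smul_eq_mul,
          hT.self, h₀₁, Prod.mk.injEq]
        constructor <;> ring) (Reach.refl H e₀)
    (hα.linear _ (mul_ne_zero (pow_ne_zero 2 ht0) hα.ne_zero) hδ _ _
      (by
        intro h
        rw [Prod.ext_iff] at h
        exact hα.ne_zero (h₀₁ ▸ h.2))
      (by
        intro h
        rw [Prod.ext_iff] at h
        exact hv0 (hinj v h.1 h.2)))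
  rw [Prod.mk.injEq] at hzv
  have : z = v := sub_eq_zero.1 (hinj _ (by rw [map_sub, LinearMap.sub_apply, hzv.1, sub_self])
    (by rw [map_sub, LinearMap.sub_apply, hzv.2, sub_self]))
  exact hT.mem_of_reach h₀ (this ▸ hz)

end IsTransvectionGroup
end Generation

section Representation

variable {F V G : Type*} [Field F] [AddCommGroup V] [Module F V] [Group G] [DistribMulAction G V]
  {B : V →ₗ[F] V →ₗ[F] F} {T : V → G} {Q : V → F}

theorem closure_fin_image {G : Type*} [Group G] (ρ : ℕ → G) {n : ℕ} (I : Set (Fin n)) :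
    Subgroup.closure ((fun i : Fin n => ρ i) '' I) = generatedBy ρ (Fin.val '' I) := by
  rw [generatedBy, Set.image_image]

theorem isStringCGroupRep_of_interval {G : Type*} [Group G] {ρ : ℕ → G} {n : ℕ}
    (h1 : ∀ i < n, ρ i ≠ 1) (hsq : ∀ i < n, ρ i * ρ i = 1)
    (hgen : generatedBy ρ (Set.Ico 0 n) = ⊤)
    (hc : ∀ i j, i + 1 < j → j < n → Commute (ρ i) (ρ j))
    (hinter : ∀ a k, k < n → ∀ g ∈ generatedBy ρ (Set.Ico a (k + 1)),
      g ∈ generatedBy ρ (Set.Ico 0 k) → g ∈ generatedBy ρ (Set.Ico a k)) :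
    IsStringCGroupRep fun i : Fin n => ρ i := by
  have hlt : ∀ I : Set (Fin n), Fin.val '' I ⊆ Set.Iio n := by
    rintro I _ ⟨i, -, rfl⟩
    exact i.2
  refine ⟨fun i => orderOf_eq_prime (by rw [sq, hsq i i.2]) (h1 i i.2), ?_,
    fun i j hij => hc i j hij j.2, fun I J => le_antisymm ?_ ?_⟩
  · rw [← Set.image_univ, closure_fin_image, ← hgen]
    congr 1
    ext i
    simp
  · rintro g ⟨hI, hJ⟩
    rw [SetLike.mem_coe, closure_fin_image] at hI hJ
    rw [closure_fin_image, Set.image_inter Fin.val_injective]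
    exact generatedBy_inter hc hinter n le_rfl _ _ (hlt I) (hlt J) g hI hJ
  · exact le_inf (Subgroup.closure_mono (Set.image_mono Set.inter_subset_left))
      (Subgroup.closure_mono (Set.image_mono Set.inter_subset_right))

namespace IsTransvectionGroup

open Submodule

theorem pathGroup_eq_top [Finite F] [CharP F 2] [FiniteDimensional F V]
    (hT : IsTransvectionGroup B T) {α t : F} {v y : ℕ → V} {N : ℕ} (hP : IsPath B Q α v y N)
    (ht0 : t ≠ 0) (ht1 : t ≠ 1) (hspan : span F (v '' Set.Ico 0 N) = ⊤) (hv0 : v N ≠ 0)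
    (hQN : Q (v N) ≠ 1) (h : 2 < Module.finrank F V ∨ N = 2 ∧ v 2 = t • v 0) :
    pathGroup T v (Set.Ico 0 (N + 1)) = ⊤ := by
  refine hT.eq_top_of_forall_mem ?_
  rcases h with hdim | ⟨rfl, hv2⟩
  · refine hT.forall_mem_of_two_lt_finrank hP.quadratic hP.exists_ne hdim (fun z hz => ?_) hv0 hQN
      (mem_pathGroup T v (by simp))
    refine pathGroup_mono T v (Set.Ico_subset_Ico_right N.le_succ)
      (hT.mem_pathGroup_of_preserves hP 0 N le_rfl _ (hT.map_smul_eq hP.quadratic hz) ?_)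
    simp [hspan]
  · refine hT.forall_mem_of_plane hP.good ht0 ht1 (mem_pathGroup T v (by simp))
      (mem_pathGroup T v (i := 1) (by simp)) (hv2 ▸ mem_pathGroup T v (by simp))
      (hP.adj 0 (by simp)) fun x hx0 hx1 => hT.nondeg x fun z => ?_
    have hz : z ∈ span F (v '' Set.Ico 0 2) := hspan ▸ mem_top
    have hle : span F (v '' Set.Ico 0 2) ≤ LinearMap.ker (B x) := by
      rw [span_le]
      rintro _ ⟨i, hi, rfl⟩
      obtain rfl | rfl : i = 0 ∨ i = 1 := by simp at hi; omega
      exacts [hx0, hx1]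
    exact hle hz

theorem isStringCGroupRep [Finite F] [CharP F 2] [FiniteDimensional F V]
    (hT : IsTransvectionGroup B T) {α t : F} {v y : ℕ → V} {N : ℕ} (hP : IsPath B Q α v y N)
    (ht0 : t ≠ 0) (ht1 : t ≠ 1) (hspan : span F (v '' Set.Ico 0 N) = ⊤) (hv0 : v N ≠ 0)
    (hQN : Q (v N) ≠ 1) (h : 2 < Module.finrank F V ∨ N = 2 ∧ v 2 = t • v 0)
    (hfar : ∀ i, i + 1 < N → B (v i) (v N) = 0) :
    IsStringCGroupRep fun i : Fin (N + 1) => T (v i) := by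
  refine isStringCGroupRep_of_interval (ρ := fun i => T (v i)) (fun i hi hone => ?_)
    (fun i _ => hT.mul_self_eq_one _) (hT.pathGroup_eq_top hP ht0 ht1 hspan hv0 hQN h)
    (fun i j hij hj => hT.commute ?_) fun a k hk g hg hg' => ?_
  · have hvi : v i ≠ 0 := by
      rcases Nat.lt_succ_iff_lt_or_eq.1 hi with hi | rfl
      · intro h0
        have := hP.norm i hi
        rw [h0, ← zero_smul F (0 : V), hP.quadratic.map_smul] at this
        simp at this
      · exact hv0
    refine hvi (hT.nondeg _ fun x => ?_)
    have := hT.smul_eq (v i) x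
    rw [show T (v i) = 1 from hone, one_smul, left_eq_add, smul_eq_zero] at this
    rw [hT.form_comm]
    exact this.resolve_right hvi
  · rw [hT.form_comm]
    rcases Nat.lt_succ_iff_lt_or_eq.1 hj with hj | rfl
    · exact hP.far i j hij hj
    · exact hfar i hij
  · rcases Nat.lt_succ_iff_lt_or_eq.1 hk with hk | rfl
    · exact hT.pathGroup_inter hP hk hg hg'
    · exact hT.pathGroup_inter_last hP hQN hg hg'

end IsTransvectionGroup
end Representation

section Symplectic

open Matrix

variable {F : Type*} [Field F] {m : ℕ}

instance symplecticAction : DistribMulAction (symplecticGroup (Fin m) F) (Fin m ⊕ Fin m → F) where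
  smul A x := A.1 *ᵥ x
  one_smul := one_mulVec
  mul_smul A C x := (mulVec_mulVec x A.1 C.1).symm
  smul_zero A := mulVec_zero A.1
  smul_add A := mulVec_add A.1

theorem symplectic_smul_def (A : symplecticGroup (Fin m) F) (x : Fin m ⊕ Fin m → F) :
    A • x = A.1 *ᵥ x := rfl

variable (F m) in
/-- The standard alternating form. -/
noncomputable def standardForm : (Fin m ⊕ Fin m → F) →ₗ[F] (Fin m ⊕ Fin m → F) →ₗ[F] F :=
  Matrix.toLinearMap₂' F (J (Fin m) F)

theorem standardForm_eq_dotProduct (x y : Fin m ⊕ Fin m → F) :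
    standardForm F m x y = x ⬝ᵥ J (Fin m) F *ᵥ y :=
  Matrix.toLinearMap₂'_apply' _ _ _

theorem standardForm_apply (x y : Fin m ⊕ Fin m → F) :
    standardForm F m x y =
      ∑ i, (x (Sum.inr i) * y (Sum.inl i) - x (Sum.inl i) * y (Sum.inr i)) := by
  rw [standardForm_eq_dotProduct, J, fromBlocks_mulVec, dotProduct, Fintype.sum_sum_type,
    Finset.sum_sub_distrib]
  simp [neg_mulVec]
  ring

theorem standardForm_self (x : Fin m ⊕ Fin m → F) : standardForm F m x x = 0 := by
  rw [standardForm_apply]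
  exact Finset.sum_eq_zero fun i _ => by ring

theorem transvection_mem (v : Fin m ⊕ Fin m → F) :
    1 + vecMulVec v (J (Fin m) F *ᵥ v) ∈ symplecticGroup (Fin m) F := by
  have h : J (Fin m) F *ᵥ J (Fin m) F *ᵥ v = -v := by
    rw [mulVec_mulVec, J_squared, neg_mulVec, one_mulVec]
  have h' : (J (Fin m) F *ᵥ v) ᵥ* J (Fin m) F = v := by
    rw [← mulVec_transpose, J_transpose, neg_mulVec, h, neg_neg]
  have h0 : v ⬝ᵥ J (Fin m) F *ᵥ v = 0 := by
    rw [← standardForm_eq_dotProduct, standardForm_self]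
  rw [SymplecticGroup.mem_iff, transpose_add, transpose_one, transpose_vecMulVec, add_mul, one_mul,
    vecMulVec_mul, h', mul_add, mul_one, add_mul, mul_vecMulVec, h, vecMulVec_mul_vecMulVec, h0,
    zero_smul, vecMulVec_zero, add_zero, neg_vecMulVec, add_neg_cancel_right]

/-- The symplectic transvection along `v`. -/
def transvectionAlong (v : Fin m ⊕ Fin m → F) : symplecticGroup (Fin m) F :=
  ⟨1 + vecMulVec v (J (Fin m) F *ᵥ v), transvection_mem v⟩

theorem isTransvectionGroup_symplectic :
    IsTransvectionGroup (standardForm F m) transvectionAlong where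
  self := standardForm_self
  nondeg x hx := by
    funext i
    rcases i with i | i
    · simpa [standardForm_apply, Pi.single_apply] using hx (Pi.single (Sum.inr i) 1)
    · simpa [standardForm_apply, Pi.single_apply] using hx (Pi.single (Sum.inl i) 1)
  smul_comm_scalar A c x := mulVec_smul A.1 c x
  faithful A hA := Subtype.ext (ext_of_mulVec_single fun i => by
    rw [OneMemClass.coe_one, one_mulVec]
    exact hA _)
  invariant A x y := by
    have h := SymplecticGroup.mem_iff'.1 A.2
    rw [standardForm_eq_dotProduct, standardForm_eq_dotProduct, symplectic_smul_def,
      symplectic_smul_def, ← vecMul_transpose, ← dotProduct_mulVec, mulVec_mulVec, mulVec_mulVec,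
      h]
  smul_eq v x := by
    rw [symplectic_smul_def, transvectionAlong, add_mulVec, one_mulVec, vecMulVec_mulVec,
      standardForm_eq_dotProduct, dotProduct_comm, op_smul_eq_smul]

/-- A quadratic form with polar form `standardForm`. -/
def weightedNorm (c : F) (x : Fin m ⊕ Fin m → F) : F :=
  ∑ i : Fin m, ((i.val + 1) * c * x (Sum.inl i) ^ 2 + x (Sum.inr i) ^ 2
    + x (Sum.inl i) * x (Sum.inr i))

theorem isQuadraticForm_weightedNorm [CharP F 2] (c : F) :
    IsQuadraticForm (standardForm F m) (weightedNorm c) where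
  map_add x y := by
    have h2 : (2 : F) = 0 := CharTwo.two_eq_zero
    rw [standardForm_apply, weightedNorm, weightedNorm, weightedNorm, ← Finset.sum_add_distrib,
      ← Finset.sum_add_distrib]
    refine Finset.sum_congr rfl fun i _ => ?_
    simp only [Pi.add_apply]
    linear_combination ((i.val + 1) * c * x (Sum.inl i) * y (Sum.inl i)
      + x (Sum.inr i) * y (Sum.inr i) + x (Sum.inl i) * y (Sum.inr i)) * h2
  map_smul d x := by
    rw [weightedNorm, weightedNorm, Finset.mul_sum]
    refine Finset.sum_congr rfl fun i _ => ?_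
    simp only [Pi.smul_apply, smul_eq_mul]
    ring

variable (F m) in
/-- The basis vector of index `a` in the first half, or zero if there is no such index. -/
def leftVec (a : ℕ) : Fin m ⊕ Fin m → F := Sum.elim (fun i => if i.val = a then 1 else 0) 0

variable (F m) in
/-- The basis vector of index `a` in the second half, or zero if there is no such index. -/
def rightVec (a : ℕ) : Fin m ⊕ Fin m → F := Sum.elim 0 (fun i => if i.val = a then 1 else 0)

variable (F m) in
/-- The basis vectors of the first half, with the index shifted by one. -/
def prevVec : ℕ → Fin m ⊕ Fin m → F
  | 0 => 0
  | a + 1 => leftVec F m a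

theorem standardForm_left_left (a b : ℕ) :
    standardForm F m (leftVec F m a) (leftVec F m b) = 0 := by
  simp [standardForm_apply, leftVec]

theorem standardForm_right_right (a b : ℕ) :
    standardForm F m (rightVec F m a) (rightVec F m b) = 0 := by
  simp [standardForm_apply, rightVec]

theorem standardForm_right_left {a b : ℕ} (ha : a < m) :
    standardForm F m (rightVec F m a) (leftVec F m b) = if a = b then 1 else 0 := by
  rw [standardForm_apply, Finset.sum_eq_single ⟨a, ha⟩]
  · simp [leftVec, rightVec]
  · intro i _ hi
    have : i.val ≠ a := fun h => hi (Fin.ext h)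
    simp [leftVec, rightVec, this]
  · simp

theorem standardForm_right_prev {a b : ℕ} (ha : a < m) :
    standardForm F m (rightVec F m a) (prevVec F m b) = if a + 1 = b then 1 else 0 := by
  cases b with
  | zero => simp [prevVec]
  | succ b => simp [prevVec, standardForm_right_left ha]

theorem standardForm_left_prev (a b : ℕ) :
    standardForm F m (leftVec F m a) (prevVec F m b) = 0 := by
  cases b with
  | zero => simp [prevVec]
  | succ b => exact standardForm_left_left a b

theorem standardForm_prev_left (a b : ℕ) :
    standardForm F m (prevVec F m a) (leftVec F m b) = 0 := by
  cases a with
  | zero => simp [prevVec]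
  | succ a => exact standardForm_left_left a b

theorem standardForm_prev_prev (a b : ℕ) :
    standardForm F m (prevVec F m a) (prevVec F m b) = 0 := by
  cases a with
  | zero => simp [prevVec]
  | succ a => exact standardForm_left_prev a b

theorem weightedNorm_left (c : F) {a : ℕ} (ha : a < m) :
    weightedNorm c (leftVec F m a) = (a + 1) * c := by
  rw [weightedNorm, Finset.sum_eq_single ⟨a, ha⟩]
  · simp [leftVec]
  · intro i _ hi
    have : i.val ≠ a := fun h => hi (Fin.ext h)
    simp [leftVec, this]
  · simp

theorem weightedNorm_right (c : F) {a : ℕ} (ha : a < m) :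
    weightedNorm c (rightVec F m a) = 1 := by
  rw [weightedNorm, Finset.sum_eq_single ⟨a, ha⟩]
  · simp [rightVec]
  · intro i _ hi
    have : i.val ≠ a := fun h => hi (Fin.ext h)
    simp [rightVec, this]
  · simp

theorem weightedNorm_prev (c : F) {a : ℕ} (ha : a ≤ m) :
    weightedNorm c (prevVec F m a) = a * c := by
  cases a with
  | zero => simp [prevVec, weightedNorm]
  | succ a => rw [prevVec, weightedNorm_left c ha, Nat.cast_succ]

/-- A path of vectors spanning the space, of norm one except for the last of them. -/
def spineVec (m : ℕ) (α t : F) (n : ℕ) : Fin m ⊕ Fin m → F :=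
  if n = 2 * m then (t * α) • prevVec F m m
  else if n % 2 = 1 then rightVec F m (n / 2)
  else α • (prevVec F m (n / 2) + leftVec F m (n / 2))

variable (F m) in
/-- A system of vectors dual to `spineVec`. -/
def coSpineVec (n : ℕ) : Fin m ⊕ Fin m → F :=
  if n % 2 = 1 then leftVec F m (n / 2) else rightVec F m (n / 2)

theorem spineVec_last (α t : F) : spineVec m α t (2 * m) = (t * α) • prevVec F m m := by
  simp [spineVec]

theorem spineVec_even (α t : F) {a : ℕ} (ha : a < m) :
    spineVec m α t (2 * a) = α • (prevVec F m a + leftVec F m a) := by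
  simp [spineVec, ha.ne]

theorem spineVec_odd (α t : F) (a : ℕ) : spineVec m α t (2 * a + 1) = rightVec F m a := by
  have h : 2 * a + 1 ≠ 2 * m := by omega
  have h' : (2 * a + 1) / 2 = a := by omega
  simp [spineVec, h, h']

theorem coSpineVec_even (a : ℕ) : coSpineVec F m (2 * a) = rightVec F m a := by
  simp [coSpineVec]

theorem coSpineVec_odd (a : ℕ) : coSpineVec F m (2 * a + 1) = leftVec F m a := by
  have h' : (2 * a + 1) / 2 = a := by omega
  simp [coSpineVec, h']

theorem standardForm_left_right [CharP F 2] {a b : ℕ} (hb : b < m) :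
    standardForm F m (leftVec F m a) (rightVec F m b) = if b = a then 1 else 0 := by
  rw [isTransvectionGroup_symplectic.form_comm, standardForm_right_left hb]

theorem standardForm_prev_right [CharP F 2] {a b : ℕ} (hb : b < m) :
    standardForm F m (prevVec F m a) (rightVec F m b) = if b + 1 = a then 1 else 0 := by
  rw [isTransvectionGroup_symplectic.form_comm, standardForm_right_prev hb]

theorem isPath_spineVec [CharP F 2] {α t : F} (hα : IsGoodParameter α)
    (ht : ∃ t : F, t ≠ 0 ∧ t ≠ 1) :
    IsPath (standardForm F m) (weightedNorm (α ^ 2)⁻¹) α (spineVec m α t) (coSpineVec F m)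
      (2 * m) where
  quadratic := isQuadraticForm_weightedNorm _
  good := hα
  exists_ne := ht
  adj i hi := by
    obtain ⟨a, rfl | rfl⟩ := i.even_or_odd'
    · have ha : a < m := by omega
      simp [spineVec_even _ _ ha, spineVec_odd, standardForm_left_right ha,
        standardForm_prev_right ha]
    · have ha : a < m := by omega
      rw [show 2 * a + 1 + 1 = 2 * (a + 1) by omega, spineVec_even _ _ (by omega : a + 1 < m)]
      simp [spineVec_odd, standardForm_right_left ha, standardForm_right_prev ha]
  far i j hij hj := by
    obtain ⟨a, rfl | rfl⟩ := i.even_or_odd' <;> obtain ⟨b, rfl | rfl⟩ := j.even_or_odd'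
    · rw [spineVec_even _ _ (by omega : a < m), spineVec_even _ _ (by omega : b < m)]
      simp [standardForm_left_left, standardForm_left_prev, standardForm_prev_left,
        standardForm_prev_prev]
    · have hb : b < m := by omega
      rw [spineVec_even _ _ (by omega : a < m), spineVec_odd]
      have h : b ≠ a := by omega
      have h' : b + 1 ≠ a := by omega
      simp [standardForm_left_right hb, standardForm_prev_right hb, h, h']
    · have ha : a < m := by omega
      rw [spineVec_odd, spineVec_even _ _ (by omega : b < m)]
      have h : a ≠ b := by omega
      have h' : a + 1 ≠ b := by omega
      simp [standardForm_right_left ha, standardForm_right_prev ha, h, h']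
    · rw [spineVec_odd, spineVec_odd, standardForm_right_right]
  norm i hi := by
    have h2 : (2 : F) = 0 := CharTwo.two_eq_zero
    obtain ⟨a, rfl | rfl⟩ := i.even_or_odd'
    · have ha : a < m := by omega
      have hinv : α ^ 2 * (α ^ 2)⁻¹ = 1 := mul_inv_cancel₀ (pow_ne_zero 2 hα.ne_zero)
      have hQ := isQuadraticForm_weightedNorm (m := m) (α ^ 2)⁻¹
      rw [spineVec_even _ _ ha, hQ.map_smul, hQ.map_add, weightedNorm_prev _ ha.le,
        weightedNorm_left _ ha, standardForm_prev_left]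
      linear_combination (2 * a + 1) * hinv + a * h2
    · rw [spineVec_odd, weightedNorm_right _ (by omega)]
  dual_zero j b hjb hb := by
    obtain ⟨a, rfl | rfl⟩ := b.even_or_odd' <;> obtain ⟨c, rfl | rfl⟩ := j.even_or_odd'
    · have ha : a < m := by omega
      rw [coSpineVec_even, spineVec_even _ _ (by omega : c < m)]
      have h : a ≠ c := by omega
      have h' : a + 1 ≠ c := by omega
      simp [standardForm_right_left ha, standardForm_right_prev ha, h, h']
    · rw [coSpineVec_even, spineVec_odd, standardForm_right_right]
    · rw [coSpineVec_odd, spineVec_even _ _ (by omega : c < m)]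
      simp [standardForm_left_left, standardForm_left_prev]
    · rw [coSpineVec_odd, spineVec_odd, standardForm_left_right (by omega),
        if_neg (by omega : c ≠ a)]
  dual_ne b hb := by
    obtain ⟨a, rfl | rfl⟩ := b.even_or_odd'
    · have ha : a < m := by omega
      rw [coSpineVec_even, spineVec_even _ _ ha]
      simp [standardForm_right_left ha, standardForm_right_prev ha, hα.ne_zero]
    · have ha : a < m := by omega
      simp [coSpineVec_odd, spineVec_odd, standardForm_left_right ha]

open Submodule in
theorem span_spineVec {α : F} (hα : α ≠ 0) (t : F) :
    span F (spineVec m α t '' Set.Ico 0 (2 * m)) = ⊤ := by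
  have hright : ∀ a < m, rightVec F m a ∈ span F (spineVec m α t '' Set.Ico 0 (2 * m)) := by
    intro a ha
    rw [← spineVec_odd α t]
    exact mem_span_image ⟨Nat.zero_le _, by omega⟩
  have hprev : ∀ a ≤ m, prevVec F m a ∈ span F (spineVec m α t '' Set.Ico 0 (2 * m)) := by
    intro a ha
    induction a with
    | zero => exact zero_mem _
    | succ a ih =>
      have h := smul_mem _ α⁻¹ (mem_span_image (F := F) (v := spineVec m α t) (i := 2 * a)
        (I := Set.Ico 0 (2 * m)) ⟨Nat.zero_le _, by omega⟩)
      rw [spineVec_even _ _ ha, inv_smul_smul₀ hα] at h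
      exact (Submodule.add_mem_iff_right _ (ih (by omega))).1 h
  refine eq_top_iff.2 fun x _ => ?_
  have hx : x = ∑ i : Fin m, (x (Sum.inl i) • leftVec F m i + x (Sum.inr i) • rightVec F m i) := by
    funext s
    rcases s with s | s <;> simp [leftVec, rightVec, Finset.sum_apply, Fin.val_inj]
  rw [hx]
  exact sum_mem fun i _ => add_mem (smul_mem _ _ (hprev (i + 1) i.2))
    (smul_mem _ _ (hright i i.2))

end Symplectic

/-- For `k ≥ 2` and `m ≥ 1`, the symplectic group `Sp(2m, F)` over the field with
`2^k` elements has a string C-group representation of rank `2m + 1`. -/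
theorem symplectic_exists_rank (k m : ℕ) (hk : 2 ≤ k) (hm : 1 ≤ m)
    (F : Type*) [Field F] [Fintype F] (hF : Fintype.card F = 2 ^ k) :
    ∃ ρ : Fin (2 * m + 1) → Matrix.symplecticGroup (Fin m) F, IsStringCGroupRep ρ := by
  have : CharP F 2 := by
    have : Fact (Nat.Prime 2) := ⟨Nat.prime_two⟩
    exact charP_of_card_eq_prime_pow hF
  have h2 : (2 : F) = 0 := CharTwo.two_eq_zero
  obtain ⟨α, hα⟩ := exists_isGoodParameter hk hF
  obtain ⟨t, ht0, ht1⟩ : ∃ t : F, t ≠ 0 ∧ t ≠ 1 := by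
    have h4 : 2 < Fintype.card F := by
      rw [hF]
      exact (by norm_num : 2 < 2 ^ 2).trans_le (Nat.pow_le_pow_right two_pos hk)
    classical
    by_contra! h
    have := Finset.card_le_card (s := Finset.univ) (t := ({0, 1} : Finset F)) fun t _ => by
      rw [Finset.mem_insert, Finset.mem_singleton, or_iff_not_imp_left]
      exact h t
    exact absurd (this.trans Finset.card_le_two) (not_le.2 h4)
  have hP := isPath_spineVec (m := m) (t := t) hα ⟨t, ht0, ht1⟩
  have hlast : spineVec m α t (2 * m) = (t * α) • prevVec F m m := spineVec_last α t
  refine ⟨_, isTransvectionGroup_symplectic.isStringCGroupRep hP ht0 ht1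
    (span_spineVec hα.ne_zero t) ?_ ?_ ?_ ?_⟩
  · rw [hlast]
    refine smul_ne_zero (mul_ne_zero ht0 hα.ne_zero) fun h => ?_
    have := standardForm_right_prev (F := F) (b := m) (by omega : m - 1 < m)
    rw [h, map_zero, if_pos (by omega)] at this
    exact zero_ne_one this
  · rw [hlast, hP.quadratic.map_smul, weightedNorm_prev _ le_rfl]
    have hinv : α ^ 2 * (α ^ 2)⁻¹ = 1 := mul_inv_cancel₀ (pow_ne_zero 2 hα.ne_zero)
    intro h
    have h' : t ^ 2 * m = 1 := by linear_combination h - t ^ 2 * m * hinv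
    obtain ⟨a, ha | ha⟩ := m.even_or_odd'
    · rw [ha] at h'
      push_cast at h'
      exact zero_ne_one (by linear_combination h' - t ^ 2 * a * h2)
    · rw [ha] at h'
      push_cast at h'
      have : (t - 1) ^ 2 = 0 := by linear_combination h' - t ^ 2 * a * h2 + (1 - t) * h2
      exact ht1 (sub_eq_zero.1 (pow_eq_zero_iff two_ne_zero |>.1 this))
  · by_cases hm1 : m = 1
    · subst hm1
      refine Or.inr ⟨rfl, ?_⟩
      have h0 := spineVec_even α t (by omega : 0 < 1)
      rw [mul_zero] at h0
      rw [hlast, h0, mul_smul]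
      simp [prevVec]
    · left
      simp
      omega
  · intro i hi
    rw [hlast]
    obtain ⟨a, rfl | rfl⟩ := i.even_or_odd'
    · rw [spineVec_even _ _ (by omega : a < m)]
      simp [standardForm_left_prev, standardForm_prev_prev]
    · have ha : a < m := by omega
      have h : a + 1 ≠ m := by omega
      simp [spineVec_odd, standardForm_right_prev ha, h]
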